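/- For τ in the Siegel upper half space ℍ_4 and ε, ε' ∈ {0,1}^3, set p[ε;ε'](τ) = θ[ε,0;ε',0](τ)·θ[ε,0;ε',1](τ), a product of two genus 4 theta constants, and define R₁(τ) = p[0,0,0;0,0,0](τ)·p[0,0,0;1,0,0](τ)·p[0,0,0;0,1,0](τ)·p[0,0,0;1,1,0](τ), R₂(τ) = p[0,0,1;0,0,0](τ)·p[0,0,1;1,0,0](τ)·p[0,0,1;0,1,0](τ)·p[0,0,1;1,1,0](τ), R₃(τ) = p[0,0,0;0,0,1](τ)·p[0,0,0;1,0,1](τ)·p[0,0,0;0,1,1](τ)·p[0,0,0;1,1,1](τ). Then there exists a constant c ∈ ℂ such that for all τ ∈ ℍ_4: R₁(τ)² + R₂(τ)² + R₃(τ)² − 2R₁(τ)R₂(τ) − 2R₁(τ)R₃(τ) − 2R₂(τ)R₃(τ) = c·(θ^{(4)}_{S(8)⊕S(8)}(τ) − θ^{(4)}_{S(16)}(τ)). -/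

import Mathlib

open scoped Matrix BigOperators
open Matrix

noncomputable section

/-- The standard Gram matrix `S(8)` of the E₈ root lattice: the (symmetric) Cartan
matrix of E₈, i.e. `2` on the diagonal and `−1` exactly at the pairs of indices joined
by an edge of the E₈ Dynkin diagram (a chain `0—1—2—3—4—5—6` with the node `7`
attached to node `2`).  It is even, positive definite, of determinant `1`. -/
def E8Gram : Matrix (Fin 8) (Fin 8) ℤ := fun i j =>
  if i = j then 2
  else if (i.val, j.val) ∈ ([(0,1),(1,2),(2,3),(3,4),(4,5),(5,6),(2,7)] : List (ℕ × ℕ)) ∨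
      (j.val, i.val) ∈ ([(0,1),(1,2),(2,3),(3,4),(4,5),(5,6),(2,7)] : List (ℕ × ℕ))
    then -1 else 0

/-- The `16 × 16` block diagonal matrix `S(8) ⊕ S(8)`. -/
def E8E8Gram : Matrix (Fin 16) (Fin 16) ℤ :=
  Matrix.reindex finSumFinEquiv finSumFinEquiv (Matrix.fromBlocks E8Gram 0 0 E8Gram)

/-- The standard Gram matrix `S(16)` of the lattice `D₁₆⁺ = D₁₆ ∪ (D₁₆ + s)`,
`s = (1/2,…,1/2)`, with respect to the basis `2e₁, e₂−e₁, …, e₁₅−e₁₄, s`.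
It is even, positive definite, of determinant `1`. -/
def D16plusGram : Matrix (Fin 16) (Fin 16) ℤ := fun i j =>
  if i = j then (if i = 0 ∨ i = 15 then 4 else 2)
  else if (i = 0 ∧ j = 15) ∨ (i = 15 ∧ j = 0) then 1
  else if i.val + 1 = j.val ∨ j.val + 1 = i.val then
    (if i = 0 ∨ j = 0 then -2 else if i = 15 ∨ j = 15 then 0 else -1)
  else 0
/-- A complex `g × g` matrix lies in the Siegel upper half space `ℍ_g` iff it is
symmetric and its imaginary part is positive definite. -/
def IsSiegel {g : ℕ} (τ : Matrix (Fin g) (Fin g) ℂ) : Prop :=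
  τ.IsSymm ∧ (Matrix.of fun i j => (τ i j).im).PosDef

/-- The theta constant `θ[ε;ε'](τ) = ∑_{m∈ℤ^g} exp[πi(ᵗ(m+ε/2)·τ·(m+ε/2) + ᵗ(m+ε/2)·ε')]`. -/
def thetaConst (g : ℕ) (ε ε' : Fin g → Fin 2) (τ : Matrix (Fin g) (Fin g) ℂ) : ℂ :=
  ∑' m : Fin g → ℤ, Complex.exp ((Real.pi : ℂ) * Complex.I *
    ((∑ i, ∑ j, ((m i : ℂ) + ((ε i : ℕ) : ℂ) / 2) * τ i j * ((m j : ℂ) + ((ε j : ℕ) : ℂ) / 2)) +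
      ∑ i, ((m i : ℂ) + ((ε i : ℕ) : ℂ) / 2) * ((ε' i : ℕ) : ℂ)))

/-- The genus `g` theta series of an integral quadratic form `S`:
`θ_S^{(g)}(τ) = ∑_{G ∈ Mat(m,g;ℤ)} exp[πi·Tr(ᵗG·S·G·τ)]`. -/
def quadThetaSeries (m g : ℕ) (S : Matrix (Fin m) (Fin m) ℤ)
    (τ : Matrix (Fin g) (Fin g) ℂ) : ℂ :=
  ∑' G : Matrix (Fin m) (Fin g) ℤ,
    Complex.exp ((Real.pi : ℂ) * Complex.I *
      Matrix.trace ((G.map (Int.cast : ℤ → ℂ))ᵀ * S.map (Int.cast : ℤ → ℂ) *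
        G.map (Int.cast : ℤ → ℂ) * τ))

/-- `p[ε;ε'](τ) = θ[ε,0;ε',0](τ)·θ[ε,0;ε',1](τ)`, a product of two genus 4 theta
constants, for `ε, ε' ∈ {0,1}³`. -/
def p (ε ε' : Fin 3 → Fin 2) (τ : Matrix (Fin 4) (Fin 4) ℂ) : ℂ :=
  thetaConst 4 (Fin.snoc ε 0) (Fin.snoc ε' 0) τ * thetaConst 4 (Fin.snoc ε 0) (Fin.snoc ε' 1) τ

/-- `R₁(τ) = p[0,0,0;0,0,0]·p[0,0,0;1,0,0]·p[0,0,0;0,1,0]·p[0,0,0;1,1,0]`. -/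
def R₁ (τ : Matrix (Fin 4) (Fin 4) ℂ) : ℂ :=
  p ![0,0,0] ![0,0,0] τ * p ![0,0,0] ![1,0,0] τ * p ![0,0,0] ![0,1,0] τ * p ![0,0,0] ![1,1,0] τ

/-- `R₂(τ) = p[0,0,1;0,0,0]·p[0,0,1;1,0,0]·p[0,0,1;0,1,0]·p[0,0,1;1,1,0]`. -/
def R₂ (τ : Matrix (Fin 4) (Fin 4) ℂ) : ℂ :=
  p ![0,0,1] ![0,0,0] τ * p ![0,0,1] ![1,0,0] τ * p ![0,0,1] ![0,1,0] τ * p ![0,0,1] ![1,1,0] τ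

/-- `R₃(τ) = p[0,0,0;0,0,1]·p[0,0,0;1,0,1]·p[0,0,0;0,1,1]·p[0,0,0;1,1,1]`. -/
def R₃ (τ : Matrix (Fin 4) (Fin 4) ℂ) : ℂ :=
  p ![0,0,0] ![0,0,1] τ * p ![0,0,0] ![1,0,1] τ * p ![0,0,0] ![0,1,1] τ * p ![0,0,0] ![1,1,1] τ

/-- The group `𝔽₂⁴` of (half-)characteristics in genus 4. -/
abbrev Char4 := Fin 4 → ZMod 2

/-- The pairing `(-1)^{a·b}` on `𝔽₂⁴`. -/
def chi (a b : Char4) : ℂ := ∏ i, (-1 : ℂ) ^ ((a i).val * (b i).val)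

theorem char4_add_self (a : Char4) : a + a = 0 := by
  funext i; exact CharTwo.add_self_eq_zero (a i)

theorem char4_add_add_cancel (a b : Char4) : a + b + b = a := by
  rw [add_assoc, char4_add_self, add_zero]

theorem chi_comm (a b : Char4) : chi a b = chi b a := by
  unfold chi; simp only [mul_comm]

theorem chi_add_right (a b c : Char4) : chi a (b + c) = chi a b * chi a c := by
  unfold chi
  rw [← Finset.prod_mul_distrib]
  refine Finset.prod_congr rfl fun i _ => ?_
  rw [← pow_add, neg_one_pow_congr]
  rw [Pi.add_apply]
  generalize a i = x
  generalize b i = y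
  generalize c i = z
  revert x y z
  decide

theorem chi_add_left (a b c : Char4) : chi (a + b) c = chi a c * chi b c := by
  rw [chi_comm, chi_add_right, chi_comm c, chi_comm c]

theorem chi_zero_right (a : Char4) : chi a 0 = 1 := by simp [chi]

theorem chi_zero_left (a : Char4) : chi 0 a = 1 := by simp [chi]

theorem chi_mul_self (a b : Char4) : chi a b * chi a b = 1 := by
  rw [← chi_add_right, char4_add_self, chi_zero_right]

theorem chi_eq_one_or (a b : Char4) : chi a b = 1 ∨ chi a b = -1 :=
  mul_self_eq_one_iff.mp (chi_mul_self a b)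

theorem exists_chi_eq_neg_one {a : Char4} (ha : a ≠ 0) : ∃ b, chi a b = -1 := by
  obtain ⟨i, hi⟩ := Function.ne_iff.mp ha
  have h1 : a i = 1 := by
    have : ∀ x : ZMod 2, x ≠ 0 → x = 1 := by decide
    exact this _ hi
  refine ⟨Pi.single i 1, ?_⟩
  unfold chi
  rw [Finset.prod_eq_single i]
  · rw [h1, Pi.single_eq_same, ZMod.val_one, mul_one, pow_one]
  · intro j _ hj
    simp [Pi.single_eq_of_ne hj]
  · simp

theorem sum_shift (f : Char4 → ℂ) (b : Char4) : ∑ x, f (x + b) = ∑ x, f x :=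
  Fintype.sum_equiv (Equiv.addRight b) _ _ fun _ => rfl

theorem sum_chi (a : Char4) : ∑ x, chi a x = if a = 0 then 16 else 0 := by
  split_ifs with h
  · subst h
    simp only [chi_zero_left, Finset.sum_const, Finset.card_univ]
    simp [ZMod.card]
  · obtain ⟨b, hb⟩ := exists_chi_eq_neg_one h
    have := sum_shift (chi a) b
    simp only [chi_add_right, hb, ← Finset.sum_mul] at this
    linear_combination -(1 / 2) * this

theorem fourier_mul (a b : Char4 → ℂ) (x : Char4) :
    (∑ κ, chi κ x * a κ) * (∑ κ, chi κ x * b κ) =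
      ∑ κ, chi κ x * ∑ l, a l * b (l + κ) := by
  rw [Finset.sum_mul_sum]
  simp only [Finset.mul_sum]
  rw [Finset.sum_comm (s := Finset.univ) (t := Finset.univ)
    (f := fun κ l => chi κ x * (a l * b (l + κ)))]
  refine Finset.sum_congr rfl fun l _ => ?_
  rw [← Equiv.sum_comp (Equiv.addLeft l)]
  refine Finset.sum_congr rfl fun κ _ => ?_
  rw [Equiv.coe_addLeft, chi_add_left]
  linear_combination (chi κ x * a l * b (l + κ)) * chi_mul_self l x

theorem sum_fourier (c : Char4 → ℂ) : ∑ x, ∑ κ, chi κ x * c κ = 16 * c 0 := by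
  rw [Finset.sum_comm]
  simp only [← Finset.sum_mul, sum_chi]
  simp

theorem parseval (a b : Char4 → ℂ) :
    ∑ x, (∑ κ, chi κ x * a κ) * (∑ κ, chi κ x * b κ) = 16 * ∑ κ, a κ * b κ := by
  simp only [fourier_mul]
  rw [sum_fourier]
  simp

theorem fourier_shift (a : Char4 → ℂ) (x δ : Char4) :
    ∑ κ, chi κ (x + δ) * a κ = ∑ κ, chi κ x * (chi κ δ * a κ) := by
  simp only [chi_add_right, mul_assoc]

/-- The Fourier transform in `δ` of the defect of a family with Fourier coefficients `T`. -/
def defectCoeff (T : Char4 → Char4 → ℂ) (l : Char4) : ℂ :=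
  ∑ κ, (∑ ε, T ε κ ^ 2) * (∑ ε, T ε (κ + l) ^ 2) - ∑ ε, (∑ κ, T ε κ * T ε (κ + l)) ^ 2

theorem defect_eq_fourier (T f : Char4 → Char4 → ℂ)
    (hf : ∀ ε x, f ε x = ∑ κ, chi κ x * T ε κ) (δ : Char4) :
    (∑ ε, ∑ x, f ε x * f ε (x + δ)) ^ 2 - 16 * ∑ ε, ∑ x, (f ε x * f ε (x + δ)) ^ 2 =
      256 * ∑ l, chi l δ * defectCoeff T l := by
  have h1 : ∀ ε, ∑ x, f ε x * f ε (x + δ) = 16 * ∑ κ, chi κ δ * T ε κ ^ 2 := by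
    intro ε
    simp only [hf, fourier_shift, parseval]
    congr 1
    exact Finset.sum_congr rfl fun κ _ => by ring
  have hsq : ∀ ε x, f ε x ^ 2 = ∑ κ, chi κ x * ∑ l, T ε l * T ε (l + κ) := by
    intro ε x
    rw [hf, sq, fourier_mul]
  have h2 : ∀ ε, ∑ x, (f ε x * f ε (x + δ)) ^ 2 =
      16 * ∑ κ, chi κ δ * (∑ l, T ε l * T ε (l + κ)) ^ 2 := by
    intro ε
    simp only [mul_pow, hsq, fourier_shift, parseval]
    congr 1
    exact Finset.sum_congr rfl fun κ _ => by ring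
  have h3 : (∑ ε, ∑ κ, chi κ δ * T ε κ ^ 2) ^ 2 =
      ∑ l, chi l δ * ∑ κ, (∑ ε, T ε κ ^ 2) * (∑ ε, T ε (κ + l) ^ 2) := by
    rw [Finset.sum_comm]
    simp only [← Finset.mul_sum]
    rw [sq, fourier_mul]
  have h4 : ∑ ε, ∑ κ, chi κ δ * (∑ l, T ε l * T ε (l + κ)) ^ 2 =
      ∑ l, chi l δ * ∑ ε, (∑ κ, T ε κ * T ε (κ + l)) ^ 2 := by
    rw [Finset.sum_comm]
    simp only [← Finset.mul_sum]
  simp only [h1, h2, ← Finset.mul_sum, defectCoeff, mul_sub, Finset.sum_sub_distrib]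
  rw [h4, mul_pow, h3]
  ring

theorem defectCoeff_zero {T : Char4 → Char4 → ℂ} (hT : ∀ ε κ, T ε κ = T κ ε) :
    defectCoeff T 0 = 0 := by
  simp only [defectCoeff, add_zero, sub_eq_zero]
  refine Finset.sum_congr rfl fun κ _ => ?_
  rw [← sq]
  congr 1
  exact Finset.sum_congr rfl fun ε _ => by rw [hT ε κ, sq]

theorem sum_eq_four {a b : Char4} (ha : a ≠ 0) (hb : b ≠ 0) (hab : b ≠ a) (f : Char4 → ℂ)
    (hf : ∀ x, x ≠ 0 → x ≠ a → x ≠ b → x ≠ a + b → f x = 0) :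
    ∑ x, f x = f 0 + f a + f b + f (a + b) := by
  have h0 : a + b ≠ 0 := fun h => hab (by
    rw [← char4_add_add_cancel b a, add_comm b a, h, zero_add])
  have h1 : a + b ≠ a := fun h => hb (by simpa using h)
  have h2 : a + b ≠ b := fun h => ha (by simpa using h)
  rw [← Finset.sum_subset (Finset.subset_univ ({0, a, b, a + b} : Finset Char4))]
  · rw [Finset.sum_insert, Finset.sum_insert, Finset.sum_insert, Finset.sum_singleton]
    · ring
    · simpa using ha
    · simp only [Finset.mem_insert, Finset.mem_singleton, not_or]
      exact ⟨hab.symm, h1.symm⟩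
    · simp only [Finset.mem_insert, Finset.mem_singleton, not_or]
      exact ⟨ha.symm, hb.symm, h0.symm⟩
  · intro x _ hx
    simp only [Finset.mem_insert, Finset.mem_singleton, not_or] at hx
    exact hf x hx.1 hx.2.1 hx.2.2.1 hx.2.2.2

/-- If `a, b` and `c, d` span mutually orthogonal planes, the annihilator of `⟨a, b⟩` is
`⟨c, d⟩`. -/
theorem mem_of_orthogonal {a b c d : Char4} (ha : a ≠ 0) (hb : b ≠ 0) (hab : b ≠ a)
    (hc : c ≠ 0) (hd : d ≠ 0) (hcd : d ≠ c)
    (hac : chi a c = 1) (had : chi a d = 1) (hbc : chi b c = 1) (hbd : chi b d = 1)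
    {x : Char4} (hax : chi a x = 1) (hbx : chi b x = 1) :
    x = 0 ∨ x = c ∨ x = d ∨ x = c + d := by
  have hab0 : a + b ≠ 0 := fun h => hab (by
    rw [← char4_add_add_cancel b a, add_comm b a, h, zero_add])
  have key : ∑ y, (1 + chi a y) * (1 + chi b y) = 16 := by
    have : ∀ y, (1 + chi a y) * (1 + chi b y) = chi 0 y + chi a y + chi b y + chi (a + b) y := by
      intro y; rw [chi_zero_left, chi_add_left]; ring
    simp only [this, Finset.sum_add_distrib, sum_chi]
    simp [ha, hb, hab0]
  have key' : ∑ y, (1 + (chi a y).re) * (1 + (chi b y).re) = 16 := by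
    have h := congrArg Complex.re key
    rw [Complex.re_sum] at h
    rw [show (16 : ℂ).re = 16 from rfl] at h
    rw [← h]
    refine Finset.sum_congr rfl fun y _ => ?_
    rcases chi_eq_one_or a y with h1 | h1 <;> rcases chi_eq_one_or b y with h2 | h2 <;>
      simp [h1, h2]
  by_contra hx
  simp only [not_or] at hx
  have hcd0 : c + d ≠ 0 := fun h => hcd (by
    rw [← char4_add_add_cancel d c, add_comm d c, h, zero_add])
  have hcd1 : c + d ≠ c := fun h => hd (by simpa using h)
  have hcd2 : c + d ≠ d := fun h => hc (by simpa using h)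
  have hle := Finset.sum_le_univ_sum_of_nonneg
    (f := fun y => (1 + (chi a y).re) * (1 + (chi b y).re)) (s := {x, 0, c, d, c + d}) (by
      intro y
      rcases chi_eq_one_or a y with h1 | h1 <;> rcases chi_eq_one_or b y with h2 | h2 <;>
        simp [h1, h2])
  rw [key', Finset.sum_insert, Finset.sum_insert, Finset.sum_insert, Finset.sum_insert,
    Finset.sum_singleton] at hle
  · simp [chi_zero_right, chi_add_right, hac, had, hbc, hbd, hax, hbx] at hle
    norm_num at hle
  · simpa using hcd2.symm
  · simp only [Finset.mem_insert, Finset.mem_singleton, not_or]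
    exact ⟨hcd.symm, hcd1.symm⟩
  · simp only [Finset.mem_insert, Finset.mem_singleton, not_or]
    exact ⟨hc.symm, hd.symm, hcd0.symm⟩
  · simp only [Finset.mem_insert, Finset.mem_singleton, not_or]
    exact ⟨hx.1, hx.2.1, hx.2.2.1, hx.2.2.2⟩

theorem exists_orthogonal (a b : Char4) : ∃ c d : Char4, c ≠ 0 ∧ d ≠ 0 ∧ d ≠ c ∧
    chi a c = 1 ∧ chi a d = 1 ∧ chi b c = 1 ∧ chi b d = 1 := by
  classical
  have key : (∑ y, (1 + (chi a y).re) * (1 + (chi b y).re) : ℝ) ≥ 16 := by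
    have h1 : ∀ c, (∑ y, (chi c y).re : ℝ) ≥ 0 := by
      intro c
      rw [← Complex.re_sum, sum_chi]
      split_ifs <;> simp
    have h2 : ∀ y, (1 + (chi a y).re) * (1 + (chi b y).re) =
        (chi 0 y).re + (chi a y).re + (chi b y).re + (chi (a + b) y).re := by
      intro y
      rw [chi_zero_left, chi_add_left]
      rcases chi_eq_one_or a y with h1 | h1 <;> rcases chi_eq_one_or b y with h2 | h2 <;>
        simp [h1, h2]
      norm_num
    have h3 : (∑ y, (chi 0 y).re : ℝ) = 16 := by
      rw [← Complex.re_sum, sum_chi]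
      simp
    simp only [h2, Finset.sum_add_distrib, h3]
    linarith [h1 a, h1 b, h1 (a + b)]
  set S : Finset Char4 := Finset.univ.filter fun y => chi a y = 1 ∧ chi b y = 1 with hS
  have h4 : (∑ y, (1 + (chi a y).re) * (1 + (chi b y).re) : ℝ) = S.card * 4 := by
    rw [← nsmul_eq_mul, ← Finset.sum_const, hS, Finset.sum_filter]
    refine Finset.sum_congr rfl fun y _ => ?_
    rcases chi_eq_one_or a y with h1 | h1 <;> rcases chi_eq_one_or b y with h2 | h2 <;>
      norm_num [h1, h2]
  have h5 : 4 ≤ S.card := by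
    have : (4 : ℝ) ≤ S.card := by linarith
    exact_mod_cast this
  have h6 : 1 < (S.erase 0).card := by
    have := Finset.pred_card_le_card_erase (s := S) (a := 0)
    omega
  obtain ⟨c, hc, d, hd, hcd⟩ := Finset.one_lt_card.mp h6
  simp only [hS, Finset.mem_erase, Finset.mem_filter, Finset.mem_univ, true_and] at hc hd
  exact ⟨c, d, hc.1, hd.1, hcd.symm, hc.2.1, hd.2.1, hc.2.2, hd.2.2⟩

theorem add_ne_zero_of_ne {a b : Char4} (hab : b ≠ a) : a + b ≠ 0 := fun h => hab (by
  rw [← char4_add_add_cancel b a, add_comm b a, h, zero_add])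

/-- The value of `defectCoeff` for an invariant symmetric `T` supported on a plane is the Igusa
quartic in its five independent entries. -/
theorem defectCoeff_eq_igusa {T : Char4 → Char4 → ℂ} (hT : ∀ ε κ, T ε κ = T κ ε)
    (hadd : ∀ ε κ, T ε (κ + ε) = T ε κ) {c d : Char4} (hc : c ≠ 0) (hd : d ≠ 0) (hcd : d ≠ c)
    (hsupp : ∀ ε κ, κ ≠ 0 → κ ≠ c → κ ≠ d → κ ≠ c + d → T ε κ = 0) :
    defectCoeff T c = 4 * (T 0 0 ^ 2 * T c d ^ 2 -
      T c d ^ 2 * (T 0 c ^ 2 + T 0 d ^ 2 + T 0 (c + d) ^ 2) +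
      (T 0 c ^ 2 * T 0 d ^ 2 + T 0 c ^ 2 * T 0 (c + d) ^ 2 + T 0 d ^ 2 * T 0 (c + d) ^ 2) -
      2 * T 0 0 * T 0 c * T 0 d * T 0 (c + d) + T c d ^ 4) := by
  have hsupp' : ∀ ε κ, ε ≠ 0 → ε ≠ c → ε ≠ d → ε ≠ c + d → T ε κ = 0 := fun ε κ h1 h2 h3 h4 => by
    rw [hT]; exact hsupp κ ε h1 h2 h3 h4
  have hself : ∀ ε, T ε ε = T 0 ε := fun ε => by
    have := hadd ε 0
    rw [zero_add] at this
    rw [this, hT]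
  have hz1 : T c (c + d) = T c d := by rw [add_comm, hadd]
  have hz2 : T d (c + d) = T c d := by rw [hadd, hT]
  have e1 : c + d + c = d := by rw [add_comm c d, char4_add_add_cancel]
  unfold defectCoeff
  have r1 : ∀ κ, ∑ ε, T ε κ ^ 2 = T 0 κ ^ 2 + T c κ ^ 2 + T d κ ^ 2 + T (c + d) κ ^ 2 := fun κ =>
    sum_eq_four hc hd hcd _ fun x h1 h2 h3 h4 => by rw [hsupp' x κ h1 h2 h3 h4]; ring
  have r2 : ∀ ε, ∑ κ, T ε κ * T ε (κ + c) = T ε 0 * T ε c + T ε c * T ε 0 + T ε d * T ε (c + d) +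
      T ε (c + d) * T ε d := fun ε => by
    rw [sum_eq_four hc hd hcd _ fun x h1 h2 h3 h4 => by rw [hsupp ε x h1 h2 h3 h4]; ring]
    rw [zero_add, char4_add_self, e1, add_comm d c]
  simp only [r1, r2]
  rw [sum_eq_four hc hd hcd _ fun x h1 h2 h3 h4 => by
    rw [hsupp 0 x h1 h2 h3 h4, hsupp c x h1 h2 h3 h4, hsupp d x h1 h2 h3 h4,
      hsupp (c + d) x h1 h2 h3 h4]; ring]
  rw [sum_eq_four hc hd hcd _ fun x h1 h2 h3 h4 => by
    rw [hsupp' x _ h1 h2 h3 h4, hsupp' x _ h1 h2 h3 h4, hsupp' x _ h1 h2 h3 h4,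
      hsupp' x _ h1 h2 h3 h4]; ring]
  rw [zero_add, char4_add_self, e1, add_comm d c]
  simp only [hself, hz1, hz2, hT c 0, hT d 0, hT (c + d) 0, hT d c, hT (c + d) c, hT (c + d) d]
  ring

/-- The Fourier coefficients of a product of four theta constants along a plane. -/
def quarticCoeff (X : Char4 → ℂ) (γ ε κ : Char4) : ℂ :=
  ∑ ρ, chi ρ γ * (X ρ * X (ρ + ε)) * (X (ρ + κ) * X (ρ + κ + ε))

theorem quarticCoeff_symm (X : Char4 → ℂ) (γ ε κ : Char4) :
    quarticCoeff X γ ε κ = quarticCoeff X γ κ ε := by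
  unfold quarticCoeff
  refine Finset.sum_congr rfl fun ρ _ => ?_
  rw [add_right_comm ρ ε κ]
  ring

theorem quarticCoeff_add (X : Char4 → ℂ) (γ ε κ : Char4) :
    quarticCoeff X γ ε (κ + ε) = quarticCoeff X γ ε κ := by
  unfold quarticCoeff
  refine Finset.sum_congr rfl fun ρ _ => ?_
  rw [← add_assoc, char4_add_add_cancel]
  ring

theorem quarticCoeff_eq_chi_mul (X : Char4 → ℂ) (γ ε κ : Char4) :
    quarticCoeff X γ ε κ = chi γ κ * quarticCoeff X γ ε κ := by
  conv_lhs => unfold quarticCoeff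
  rw [← sum_shift _ κ, quarticCoeff, Finset.mul_sum]
  refine Finset.sum_congr rfl fun ρ _ => ?_
  rw [char4_add_add_cancel, chi_add_left, chi_comm κ γ]
  ring

theorem quarticCoeff_eq_chi_mul' {X : Char4 → ℂ} {β : Char4} (hX : ∀ σ, X σ = chi β σ * X σ)
    (γ ε κ : Char4) : quarticCoeff X γ ε κ = chi β κ * quarticCoeff X γ ε κ := by
  unfold quarticCoeff
  rw [Finset.mul_sum]
  refine Finset.sum_congr rfl fun ρ _ => ?_
  have h1 : X ρ * X (ρ + κ) = chi β κ * (X ρ * X (ρ + κ)) := by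
    conv_lhs => rw [hX ρ, hX (ρ + κ), chi_add_right]
    linear_combination (X ρ * X (ρ + κ) * chi β κ) * chi_mul_self β ρ
  linear_combination (chi ρ γ * X (ρ + ε) * X (ρ + κ + ε)) * h1

theorem quarticCoeff_fourier (X : Char4 → ℂ) (γ ε x : Char4) :
    (∑ σ, chi σ x * (X σ * X (σ + ε))) * (∑ σ, chi σ (x + γ) * (X σ * X (σ + ε))) =
      ∑ κ, chi κ x * quarticCoeff X γ ε κ := by
  rw [mul_comm, fourier_shift, fourier_mul]
  rfl

theorem defectCoeff_plane {X : Char4 → ℂ} {β γ : Char4} (hX : ∀ σ, X σ = chi β σ * X σ)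
    (hβ : β ≠ 0) (hγ : γ ≠ 0) (hβγ : γ ≠ β) :
    ∃ D : ℂ, (∑ l, chi l 0 * defectCoeff (quarticCoeff X γ) l = 3 * D) ∧
      ∀ δ, δ ≠ 0 → δ ≠ β → δ ≠ γ → δ ≠ β + γ →
        ∑ l, chi l δ * defectCoeff (quarticCoeff X γ) l = -D := by
  obtain ⟨c, d, hc, hd, hcd, hβc, hβd, hγc, hγd⟩ := exists_orthogonal β γ
  set T := quarticCoeff X γ with hTdef
  have hT : ∀ ε κ, T ε κ = T κ ε := quarticCoeff_symm X γ
  have hadd : ∀ ε κ, T ε (κ + ε) = T ε κ := quarticCoeff_add X γ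
  have hz : ∀ {s t : ℂ}, t = s * t → s = -1 → t = 0 := by
    intro s t h hs
    rw [hs] at h
    linear_combination (1 / 2) * h
  have hTβ : ∀ ε κ, chi β κ = -1 → T ε κ = 0 := fun ε κ h =>
    hz (quarticCoeff_eq_chi_mul' hX γ ε κ) h
  have hTγ : ∀ ε κ, chi γ κ = -1 → T ε κ = 0 := fun ε κ h =>
    hz (quarticCoeff_eq_chi_mul X γ ε κ) h
  have hmem : ∀ l, l ≠ 0 → l ≠ c → l ≠ d → l ≠ c + d → chi β l = -1 ∨ chi γ l = -1 := by
    intro l h1 h2 h3 h4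
    rcases chi_eq_one_or β l with h5 | h5
    · rcases chi_eq_one_or γ l with h6 | h6
      · rcases mem_of_orthogonal hβ hγ hβγ hc hd hcd hβc hβd hγc hγd h5 h6 with h | h | h | h
        all_goals contradiction
      · exact Or.inr h6
    · exact Or.inl h5
  have hsupp : ∀ ε κ, κ ≠ 0 → κ ≠ c → κ ≠ d → κ ≠ c + d → T ε κ = 0 := by
    intro ε κ h1 h2 h3 h4
    rcases hmem κ h1 h2 h3 h4 with h | h
    · exact hTβ ε κ h
    · exact hTγ ε κ h
  have hprod : ∀ ε ε' κ l, (chi β l = -1 ∨ chi γ l = -1) → T ε κ * T ε' (κ + l) = 0 := by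
    intro ε ε' κ l h
    rcases h with h | h
    · rcases chi_eq_one_or β κ with h1 | h1
      · rw [hTβ ε' (κ + l) (by rw [chi_add_right, h1, h, one_mul]), mul_zero]
      · rw [hTβ ε κ h1, zero_mul]
    · rcases chi_eq_one_or γ κ with h1 | h1
      · rw [hTγ ε' (κ + l) (by rw [chi_add_right, h1, h, one_mul]), mul_zero]
      · rw [hTγ ε κ h1, zero_mul]
  have hD : ∀ l, l ≠ 0 → l ≠ c → l ≠ d → l ≠ c + d → defectCoeff T l = 0 := by
    intro l h1 h2 h3 h4
    have h := hmem l h1 h2 h3 h4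
    unfold defectCoeff
    rw [Finset.sum_eq_zero, Finset.sum_eq_zero, sub_zero]
    · intro ε _
      rw [Finset.sum_eq_zero fun κ _ => hprod ε ε κ l h]
      ring
    · intro κ _
      rw [Finset.sum_mul_sum]
      refine Finset.sum_eq_zero fun ε _ => Finset.sum_eq_zero fun ε' _ => ?_
      rw [← mul_pow, hprod ε ε' κ l h]
      ring
  have h0 : defectCoeff T 0 = 0 := defectCoeff_zero hT
  have hcd0 := add_ne_zero_of_ne hcd
  have hcdc : c ≠ c + d := fun h => hd (by simpa using h.symm)
  have e1 : c + d + c = d := by rw [add_comm c d, char4_add_add_cancel]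
  have hz1 : T (c + d) c = T c d := by rw [hT, add_comm c d, hadd]
  have hDc := defectCoeff_eq_igusa hT hadd hc hd hcd hsupp
  have hDd : defectCoeff T d = defectCoeff T c := by
    rw [hDc, defectCoeff_eq_igusa hT hadd hd hc hcd.symm (by
      intro ε κ h1 h2 h3 h4
      exact hsupp ε κ h1 h3 h2 (by rwa [add_comm])), hT d c, add_comm d c]
    ring
  have hDcd : defectCoeff T (c + d) = defectCoeff T c := by
    rw [hDc, defectCoeff_eq_igusa hT hadd hcd0 hc hcdc (by
      intro ε κ h1 h2 h3 h4
      exact hsupp ε κ h1 h3 (by rwa [e1] at h4) h2), hz1, e1]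
    ring
  have hsum : ∀ δ, ∑ l, chi l δ * defectCoeff T l =
      (chi c δ + chi d δ + chi c δ * chi d δ) * defectCoeff T c := by
    intro δ
    rw [sum_eq_four hc hd hcd _ fun l h1 h2 h3 h4 => by rw [hD l h1 h2 h3 h4, mul_zero],
      h0, hDd, hDcd, chi_add_left]
    ring
  refine ⟨defectCoeff T c, ?_, ?_⟩
  · rw [hsum]
    simp only [chi_zero_right]
    ring
  · intro δ h1 h2 h3 h4
    rw [hsum]
    rcases chi_eq_one_or c δ with h5 | h5 <;> rcases chi_eq_one_or d δ with h6 | h6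
    · rw [chi_comm] at hβc hβd hγc hγd
      rcases mem_of_orthogonal hc hd hcd hβ hγ hβγ hβc hγc hβd hγd h5 h6 with h | h | h | h
      all_goals contradiction
    all_goals
      rw [h5, h6]
      ring

/-- The product of the eight theta constants along `x + ⟨β, γ, δ⟩`. -/
def octad (th : Char4 → Char4 → ℂ) (β γ δ ε x : Char4) : ℂ :=
  th ε x * th ε (x + β) * th ε (x + γ) * th ε (x + β + γ) *
    (th ε (x + δ) * th ε (x + β + δ) * th ε (x + γ + δ) * th ε (x + β + γ + δ))

def octadDefect (th : Char4 → Char4 → ℂ) (β γ δ : Char4) : ℂ :=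
  (∑ ε, ∑ x, octad th β γ δ ε x) ^ 2 - 16 * ∑ ε, ∑ x, octad th β γ δ ε x ^ 2

section
variable {th : Char4 → Char4 → ℂ}

theorem octadDefect_swap₁₂ (β γ δ : Char4) : octadDefect th β γ δ = octadDefect th γ β δ := by
  have : octad th β γ δ = octad th γ β δ := by
    funext ε x
    unfold octad
    rw [add_right_comm x β γ]
    ring
  unfold octadDefect
  rw [this]

theorem octadDefect_swap₂₃ (β γ δ : Char4) : octadDefect th β γ δ = octadDefect th β δ γ := by
  have : octad th β γ δ = octad th β δ γ := by
    funext ε x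
    unfold octad
    rw [add_right_comm x γ δ, add_right_comm (x + β) γ δ]
    ring
  unfold octadDefect
  rw [this]

theorem octadDefect_self (β : Char4) : octadDefect th β β 0 = octadDefect th β 0 0 := by
  have : octad th β β 0 = octad th β 0 0 := by
    funext ε x
    unfold octad
    simp only [add_zero, char4_add_add_cancel]
    ring
  unfold octadDefect
  rw [this]

variable {X : Char4 → Char4 → ℂ}

theorem octad_eq_mul
    (h : ∀ β ε x, th ε x * th ε (x + β) =
      chi (ε * x) β * ∑ σ, chi σ x * (X β σ * X β (σ + ε))) (β γ δ ε x : Char4) :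
    octad th β γ δ ε x = (∑ κ, chi κ x * quarticCoeff (X β) γ ε κ) *
      (∑ κ, chi κ (x + δ) * quarticCoeff (X β) γ ε κ) := by
  rw [← quarticCoeff_fourier, ← quarticCoeff_fourier]
  have h1 := h β ε x
  have h2 := h β ε (x + γ)
  have h3 := h β ε (x + δ)
  have h4 := h β ε (x + δ + γ)
  rw [add_right_comm] at h2 h3
  rw [add_right_comm x δ γ, add_right_comm (x + γ) δ β, add_right_comm x γ β] at h4
  have hs : chi (ε * x) β * chi (ε * (x + γ)) β * chi (ε * (x + δ)) β *
      chi (ε * (x + γ + δ)) β = 1 := by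
    simp only [mul_add, chi_add_left]
    have e1 := chi_mul_self (ε * x) β
    have e2 := chi_mul_self (ε * γ) β
    have e3 := chi_mul_self (ε * δ) β
    calc _ = (chi (ε * x) β * chi (ε * x) β) * (chi (ε * x) β * chi (ε * x) β) *
        (chi (ε * γ) β * chi (ε * γ) β) * (chi (ε * δ) β * chi (ε * δ) β) := by ring
      _ = 1 := by rw [e1, e2, e3]; norm_num
  calc octad th β γ δ ε x = (th ε x * th ε (x + β)) * (th ε (x + γ) * th ε (x + β + γ)) *
        ((th ε (x + δ) * th ε (x + β + δ)) * (th ε (x + γ + δ) * th ε (x + β + γ + δ))) := by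
        unfold octad; ring
    _ = _ := by
      rw [h1, h2, h3, h4, add_right_comm x δ γ]
      linear_combination ((∑ σ, chi σ x * (X β σ * X β (σ + ε))) *
        (∑ σ, chi σ (x + γ) * (X β σ * X β (σ + ε))) *
        (∑ σ, chi σ (x + δ) * (X β σ * X β (σ + ε))) *
        (∑ σ, chi σ (x + γ + δ) * (X β σ * X β (σ + ε)))) * hs

theorem octadDefect_eq_fourier
    (h : ∀ β ε x, th ε x * th ε (x + β) =
      chi (ε * x) β * ∑ σ, chi σ x * (X β σ * X β (σ + ε))) (β γ δ : Char4) :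
    octadDefect th β γ δ = 256 * ∑ l, chi l δ * defectCoeff (quarticCoeff (X β) γ) l := by
  unfold octadDefect
  simp only [octad_eq_mul h]
  exact defect_eq_fourier (quarticCoeff (X β) γ)
    (fun ε x => ∑ κ, chi κ x * quarticCoeff (X β) γ ε κ) (fun _ _ => rfl) δ

theorem sum_octadDefect
    (h : ∀ β ε x, th ε x * th ε (x + β) =
      chi (ε * x) β * ∑ σ, chi σ x * (X β σ * X β (σ + ε))) (β γ : Char4) :
    ∑ δ, octadDefect th β γ δ = 0 := by
  simp only [octadDefect_eq_fourier h, ← Finset.mul_sum]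
  rw [sum_fourier, defectCoeff_zero (quarticCoeff_symm _ _)]
  ring

theorem octadDefect_plane
    (h : ∀ β ε x, th ε x * th ε (x + β) =
      chi (ε * x) β * ∑ σ, chi σ x * (X β σ * X β (σ + ε)))
    (hX : ∀ β σ, X β σ = chi β σ * X β σ) {β γ δ : Char4} (hβ : β ≠ 0) (hγ : γ ≠ 0)
    (hβγ : γ ≠ β) (h1 : δ ≠ 0) (h2 : δ ≠ β) (h3 : δ ≠ γ) (h4 : δ ≠ β + γ) :
    octadDefect th β γ 0 = -3 * octadDefect th β γ δ := by
  obtain ⟨D, hD0, hD⟩ := defectCoeff_plane (γ := γ) (hX β) hβ hγ hβγ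
  rw [octadDefect_eq_fourier h, octadDefect_eq_fourier h, hD0, hD δ h1 h2 h3 h4]
  ring

theorem exists_notMem_six (a b c d e f : Char4) :
    ∃ x : Char4, x ≠ a ∧ x ≠ b ∧ x ≠ c ∧ x ≠ d ∧ x ≠ e ∧ x ≠ f := by
  classical
  by_contra hx
  push Not at hx
  have hsub : (Finset.univ : Finset Char4) ⊆ {a, b, c, d, e, f} := by
    intro x _
    simp only [Finset.mem_insert, Finset.mem_singleton]
    have := hx x
    tauto
  have h1 := Finset.card_le_card hsub
  have h2 := Finset.card_le_six (a := a) (b := b) (c := c) (d := d) (e := e) (f := f)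
  have h3 : (Finset.univ : Finset Char4).card = 16 := by
    simp [Finset.card_univ, ZMod.card]
  omega

theorem octadDefect_plane_congr_right
    (h : ∀ β ε x, th ε x * th ε (x + β) =
      chi (ε * x) β * ∑ σ, chi σ x * (X β σ * X β (σ + ε)))
    (hX : ∀ β σ, X β σ = chi β σ * X β σ) {β γ γ' : Char4} (hβ : β ≠ 0) (hγ : γ ≠ 0)
    (hβγ : γ ≠ β) (hγ' : γ' ≠ 0) (hβγ' : γ' ≠ β) :
    octadDefect th β γ 0 = octadDefect th β γ' 0 := by
  obtain ⟨δ, h1, h2, h3, h4, h5, h6⟩ := exists_notMem_six 0 β γ γ' (β + γ) (β + γ')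
  have key : ∀ γ, γ ≠ 0 → γ ≠ β → δ ≠ γ → δ ≠ β + γ →
      octadDefect th β γ 0 = octadDefect th β δ 0 := by
    intro γ a1 a2 a3 a4
    rw [octadDefect_plane h hX hβ a1 a2 h1 h2 a3 a4, octadDefect_swap₂₃,
      octadDefect_plane h hX hβ h1 h2 a1 a2 a3.symm]
    intro a5
    exact a4 (by rw [a5, ← add_assoc, char4_add_self, zero_add])
  rw [key γ hγ hβγ h3 h5, key γ' hγ' hβγ' h4 h6]

theorem octadDefect_plane_congr
    (h : ∀ β ε x, th ε x * th ε (x + β) =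
      chi (ε * x) β * ∑ σ, chi σ x * (X β σ * X β (σ + ε)))
    (hX : ∀ β σ, X β σ = chi β σ * X β σ) {β γ β' γ' : Char4} (hβ : β ≠ 0) (hγ : γ ≠ 0)
    (hβγ : γ ≠ β) (hβ' : β' ≠ 0) (hγ' : γ' ≠ 0) (hβγ' : γ' ≠ β') :
    octadDefect th β γ 0 = octadDefect th β' γ' 0 := by
  by_cases hb : β' = β
  · subst hb
    exact octadDefect_plane_congr_right h hX hβ hγ hβγ hγ' hβγ'
  · rw [octadDefect_plane_congr_right h hX hβ hγ hβγ hβ' hb, octadDefect_swap₁₂,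
      octadDefect_plane_congr_right h hX hβ' hβ (Ne.symm hb) hγ' hβγ']

theorem octadDefect_zero
    (h : ∀ β ε x, th ε x * th ε (x + β) =
      chi (ε * x) β * ∑ σ, chi σ x * (X β σ * X β (σ + ε)))
    (hX : ∀ β σ, X β σ = chi β σ * X β σ) {β γ δ : Char4} (hβ : β ≠ 0) (hγ : γ ≠ 0)
    (hβγ : γ ≠ β) (h1 : δ ≠ 0) (h2 : δ ≠ β) (h3 : δ ≠ γ) (h4 : δ ≠ β + γ) :
    octadDefect th 0 0 0 = -315 * octadDefect th β γ δ := by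
  classical
  have hk := octadDefect_plane h hX hβ hγ hβγ h1 h2 h3 h4
  set k := octadDefect th β γ δ
  have hcard : Fintype.card Char4 = 16 := by simp [ZMod.card]
  have hline : ∀ a : Char4, a ≠ 0 → octadDefect th a 0 0 = 21 * k := by
    intro a ha
    have hs := sum_octadDefect h a 0
    have hval : ∀ b, octadDefect th a 0 b =
        -3 * k + (if b = 0 then octadDefect th a 0 0 + 3 * k else 0) +
          (if b = a then octadDefect th a 0 0 + 3 * k else 0) := by
      intro b
      rw [octadDefect_swap₂₃]
      by_cases hb0 : b = 0
      · subst hb0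
        simp [ha.symm]
      · by_cases hba : b = a
        · subst hba
          rw [octadDefect_self]
          simp [ha]
        · rw [octadDefect_plane_congr h hX ha hb0 hba hβ hγ hβγ, hk]
          simp [hb0, hba]
    rw [Finset.sum_congr rfl fun b _ => hval b] at hs
    simp only [Finset.sum_add_distrib, Finset.sum_const, Finset.card_univ, hcard,
      Finset.sum_ite_eq', Finset.mem_univ, if_true, nsmul_eq_mul] at hs
    push_cast at hs
    linear_combination (1 / 2) * hs
  have hs := sum_octadDefect h 0 0
  have hval : ∀ b, octadDefect th 0 0 b =
      21 * k + (if b = 0 then octadDefect th 0 0 0 - 21 * k else 0) := by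
    intro b
    by_cases hb0 : b = 0
    · subst hb0
      simp
    · rw [octadDefect_swap₂₃, octadDefect_swap₁₂, hline b hb0]
      simp [hb0]
  rw [Finset.sum_congr rfl fun b _ => hval b] at hs
  simp only [Finset.sum_add_distrib, Finset.sum_const, Finset.card_univ, hcard,
    Finset.sum_ite_eq', Finset.mem_univ, if_true, nsmul_eq_mul] at hs
  push_cast at hs
  linear_combination hs
end

theorem octad_eq_zero {th : Char4 → Char4 → ℂ} (hth : ∀ ε x, th ε x = chi ε x * th ε x)
    {β γ δ ε : Char4} (h : chi ε β = -1 ∨ chi ε γ = -1 ∨ chi ε δ = -1) (x : Char4) :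
    octad th β γ δ ε x = 0 := by
  have key : ∀ b, chi ε b = -1 → th ε x * th ε (x + b) = 0 := by
    intro b hb
    have h1 := hth ε x
    have h2 := hth ε (x + b)
    rw [chi_add_right, hb] at h2
    rcases chi_eq_one_or ε x with h3 | h3
    · rw [h3] at h2
      linear_combination (th ε x / 2) * h2
    · rw [h3] at h1
      linear_combination (th ε (x + b) / 2) * h1
  unfold octad
  rcases h with h | h | h
  · linear_combination (th ε (x + γ) * th ε (x + β + γ) *
      (th ε (x + δ) * th ε (x + β + δ) * th ε (x + γ + δ) * th ε (x + β + γ + δ))) * key β h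
  · linear_combination (th ε (x + β) * th ε (x + β + γ) *
      (th ε (x + δ) * th ε (x + β + δ) * th ε (x + γ + δ) * th ε (x + β + γ + δ))) * key γ h
  · linear_combination (th ε (x + β) * th ε (x + γ) * th ε (x + β + γ) *
      (th ε (x + β + δ) * th ε (x + γ + δ) * th ε (x + β + γ + δ))) * key δ h

theorem octad_add₁ (th : Char4 → Char4 → ℂ) (β γ δ ε x : Char4) :
    octad th β γ δ ε (x + β) = octad th β γ δ ε x := by
  simp only [octad, char4_add_add_cancel]
  ring

theorem octad_add₂ (th : Char4 → Char4 → ℂ) (β γ δ ε x : Char4) :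
    octad th β γ δ ε (x + γ) = octad th β γ δ ε x := by
  simp only [octad, add_right_comm x γ β, char4_add_add_cancel]
  ring

theorem octad_add₃ (th : Char4 → Char4 → ℂ) (β γ δ ε x : Char4) :
    octad th β γ δ ε (x + δ) = octad th β γ δ ε x := by
  simp only [octad, add_right_comm x δ β, add_right_comm x δ γ, add_right_comm (x + β) δ γ,
    char4_add_add_cancel]
  ring

theorem sum_char4 (f : Char4 → ℂ) :
    ∑ x, f x = ∑ a, ∑ b, ∑ c, ∑ d, f ![a, b, c, d] := by
  let e : (ZMod 2 × ZMod 2 × ZMod 2 × ZMod 2) ≃ Char4 :=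
    { toFun := fun p => ![p.1, p.2.1, p.2.2.1, p.2.2.2]
      invFun := fun x => (x 0, x 1, x 2, x 3)
      left_inv := fun _ => rfl
      right_inv := fun x => by funext i; fin_cases i <;> rfl }
  rw [← Equiv.sum_comp e, Fintype.sum_prod_type]
  simp only [Fintype.sum_prod_type]
  rfl

theorem sum_zmod_two (f : ZMod 2 → ℂ) : ∑ x, f x = f 0 + f 1 := Fin.sum_univ_two f

theorem sum_sum_octad {th : Char4 → Char4 → ℂ} (hth : ∀ ε x, th ε x = chi ε x * th ε x)
    (g : ℂ → ℂ) (hg : g 0 = 0) :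
    ∑ ε, ∑ x, g (octad th ![1, 0, 0, 0] ![0, 1, 0, 0] ![0, 0, 0, 1] ε x) =
      8 * (g (octad th ![1, 0, 0, 0] ![0, 1, 0, 0] ![0, 0, 0, 1] 0 0) +
        g (octad th ![1, 0, 0, 0] ![0, 1, 0, 0] ![0, 0, 0, 1] ![0, 0, 1, 0] 0) +
        g (octad th ![1, 0, 0, 0] ![0, 1, 0, 0] ![0, 0, 0, 1] 0 ![0, 0, 1, 0])) := by
  set F := octad th ![1, 0, 0, 0] ![0, 1, 0, 0] ![0, 0, 0, 1] with hF
  have hx : ∀ ε (a b c d : ZMod 2), F ε ![a, b, c, d] = F ε ![0, 0, c, 0] := by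
    intro ε a b c d
    have two : ∀ y : ZMod 2, y = 0 ∨ y = 1 := by decide
    have s1 : ∀ a, F ε ![a, b, c, d] = F ε ![0, b, c, d] := by
      intro a
      rcases two a with rfl | rfl
      · rfl
      · rw [hF, ← octad_add₁ th _ _ _ ε ![0, b, c, d]]
        simp
    have s2 : ∀ b, F ε ![0, b, c, d] = F ε ![0, 0, c, d] := by
      intro b
      rcases two b with rfl | rfl
      · rfl
      · rw [hF, ← octad_add₂ th _ _ _ ε ![0, 0, c, d]]
        simp
    have s3 : ∀ d, F ε ![0, 0, c, d] = F ε ![0, 0, c, 0] := by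
      intro d
      rcases two d with rfl | rfl
      · rfl
      · rw [hF, ← octad_add₃ th _ _ _ ε ![0, 0, c, 0]]
        simp
    rw [s1, s2, s3]
  have hsx : ∀ ε, ∑ x, g (F ε x) = 8 * (g (F ε ![0, 0, 0, 0]) + g (F ε ![0, 0, 1, 0])) := by
    intro ε
    rw [sum_char4]
    simp only [sum_zmod_two]
    simp only [hx ε 1, hx ε 0 1, hx ε 0 0 _ 1]
    ring
  have hε : ∀ ε : Char4, ε 0 = 1 ∨ ε 1 = 1 ∨ ε 3 = 1 → ∀ x, F ε x = 0 := by
    intro ε h x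
    refine octad_eq_zero hth ?_ x
    simp only [chi, Fin.prod_univ_four]
    rcases h with h | h | h
    · left; simp [h, ZMod.val_one]
    · right; left; simp [h, ZMod.val_one]
    · right; right; simp [h, ZMod.val_one]
  have hlast : F ![0, 0, 1, 0] ![0, 0, 1, 0] = 0 := by
    have h1 := hth ![0, 0, 1, 0] ![0, 0, 1, 0]
    have h2 : chi ![0, 0, 1, 0] ![0, 0, 1, 0] = -1 := by
      simp [chi, Fin.prod_univ_four, ZMod.val_one]
    rw [h2] at h1
    have h3 : th ![0, 0, 1, 0] ![0, 0, 1, 0] = 0 := by linear_combination h1 / 2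
    rw [hF, octad, h3]
    ring
  have hz : (![0, 0, 0, 0] : Char4) = 0 := by decide
  have h1 : ∀ b c d : ZMod 2, ∀ x, F ![1, b, c, d] x = 0 := fun b c d => hε _ (Or.inl rfl)
  have h2 : ∀ a c d : ZMod 2, ∀ x, F ![a, 1, c, d] x = 0 := fun a c d => hε _ (Or.inr (Or.inl rfl))
  have h3 : ∀ a b c : ZMod 2, ∀ x, F ![a, b, c, 1] x = 0 := fun a b c => hε _ (Or.inr (Or.inr rfl))
  simp only [hsx]
  rw [sum_char4]
  simp only [sum_zmod_two, h1, h2, h3, hg, hlast, hz]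
  ring

theorem octadDefect_standard {th : Char4 → Char4 → ℂ} (hth : ∀ ε x, th ε x = chi ε x * th ε x)
    {r₁ r₂ r₃ : ℂ}
    (h₁ : octad th ![1, 0, 0, 0] ![0, 1, 0, 0] ![0, 0, 0, 1] 0 0 = r₁)
    (h₂ : octad th ![1, 0, 0, 0] ![0, 1, 0, 0] ![0, 0, 0, 1] ![0, 0, 1, 0] 0 = r₂)
    (h₃ : octad th ![1, 0, 0, 0] ![0, 1, 0, 0] ![0, 0, 0, 1] 0 ![0, 0, 1, 0] = r₃) :
    octadDefect th ![1, 0, 0, 0] ![0, 1, 0, 0] ![0, 0, 0, 1] =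
      -64 * (r₁ ^ 2 + r₂ ^ 2 + r₃ ^ 2 - 2 * r₁ * r₂ - 2 * r₁ * r₃ - 2 * r₂ * r₃) := by
  unfold octadDefect
  have e₁ := sum_sum_octad hth (fun z => z) rfl
  have e₂ := sum_sum_octad hth (fun z => z ^ 2) (by norm_num)
  simp only [h₁, h₂, h₃] at e₁ e₂
  rw [e₁, e₂]
  ring

theorem octadDefect_zero_zero_zero (th : Char4 → Char4 → ℂ) :
    octadDefect th 0 0 0 = (∑ ε, ∑ x, th ε x ^ 8) ^ 2 - 16 * ∑ ε, ∑ x, th ε x ^ 16 := by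
  have h : ∀ ε x, octad th 0 0 0 ε x = th ε x ^ 8 := by
    intro ε x
    simp only [octad, add_zero]
    ring
  simp only [octadDefect, h, ← pow_mul]

theorem summable_norm_prod_pow {R α : Type*} [NormedField R] [CompleteSpace R] {f : α → R}
    (hf : Summable fun a => ‖f a‖) (n : ℕ) :
    (Summable fun x : Fin n → α => ‖∏ i, f (x i)‖) ∧
      ∑' x : Fin n → α, ∏ i, f (x i) = (∑' a, f a) ^ n := by
  induction n with
  | zero =>
    refine ⟨(hasSum_fintype _).summable, ?_⟩
    rw [tsum_fintype]
    simp
  | succ n ih =>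
    have key : ∀ q : α × (Fin n → α), ∏ i, f (Fin.consEquiv (fun _ => α) q i) =
        f q.1 * ∏ i, f (q.2 i) := by
      intro q
      rw [Fin.prod_univ_succ]
      simp [Fin.consEquiv]
    constructor
    · rw [← (Fin.consEquiv fun _ : Fin (n + 1) => α).summable_iff]
      refine (hf.mul_norm ih.1).congr fun q => ?_
      simp only [Function.comp_apply]
      rw [key]
    · rw [← (Fin.consEquiv fun _ : Fin (n + 1) => α).tsum_eq, pow_succ', ← ih.2,
        tsum_mul_tsum_of_summable_norm hf ih.1]
      exact tsum_congr key

theorem summable_exp_neg_mul_sq {c : ℝ} (hc : 0 < c) :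
    Summable fun n : ℤ => Real.exp (-c * (n : ℝ) ^ 2) := by
  have h := (summable_jacobiTheta₂_term_iff 0 (c / Real.pi * Complex.I)).mpr (by
    simpa using div_pos hc Real.pi_pos)
  refine h.norm.congr fun n => ?_
  rw [norm_jacobiTheta₂_term]
  have : ((c / Real.pi * Complex.I : ℂ)).im = c / Real.pi := by
    rw [← Complex.ofReal_div]; simp
  rw [this]
  congr 1
  simp
  field_simp

theorem exists_quadratic_lower_bound {Y : Matrix (Fin 4) (Fin 4) ℝ} (hY : Y.PosDef) :
    ∃ c : ℝ, 0 < c ∧ ∀ v : Fin 4 → ℝ, c * ∑ i, v i ^ 2 ≤ ∑ i, ∑ j, v i * Y i j * v j := by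
  set Q : (Fin 4 → ℝ) → ℝ := fun v => ∑ i, ∑ j, v i * Y i j * v j with hQ
  have hpos : ∀ v, v ≠ 0 → 0 < Q v := by
    intro v hv
    have := hY.dotProduct_mulVec_pos hv
    simpa [hQ, dotProduct, mulVec, Finset.mul_sum, mul_assoc] using this
  have hcont : Continuous Q := by fun_prop
  have hscale : ∀ (t : ℝ) v, Q (t • v) = t ^ 2 * Q v := by
    intro t v
    simp only [hQ, Finset.mul_sum, Pi.smul_apply, smul_eq_mul]
    exact Finset.sum_congr rfl fun i _ => Finset.sum_congr rfl fun j _ => by ring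
  obtain ⟨v₀, hv₀, hmin⟩ := (isCompact_sphere (0 : Fin 4 → ℝ) 1).exists_isMinOn
    ((NormedSpace.sphere_nonempty).mpr zero_le_one) hcont.continuousOn
  have hv₀' : v₀ ≠ 0 := by
    rintro rfl
    simp at hv₀
  refine ⟨Q v₀ / 4, by have := hpos v₀ hv₀'; positivity, fun v => ?_⟩
  by_cases hv : v = 0
  · subst hv; simp [hQ]
  have hn : 0 < ‖v‖ := norm_pos_iff.mpr hv
  have h1 : Q v₀ ≤ Q (‖v‖⁻¹ • v) := hmin (by simp [norm_smul, hn.ne'])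
  rw [hscale] at h1
  have h2 : Q v₀ * ‖v‖ ^ 2 ≤ Q v := by
    calc Q v₀ * ‖v‖ ^ 2 ≤ (‖v‖⁻¹ ^ 2 * Q v) * ‖v‖ ^ 2 := by gcongr
      _ = Q v := by field_simp
  have h3 : ∑ i, v i ^ 2 ≤ 4 * ‖v‖ ^ 2 := by
    have : ∀ i, v i ^ 2 ≤ ‖v‖ ^ 2 := fun i => by
      rw [← sq_abs, ← Real.norm_eq_abs]
      exact pow_le_pow_left₀ (norm_nonneg _) (norm_le_pi_norm v i) 2
    calc ∑ i, v i ^ 2 ≤ ∑ _i : Fin 4, ‖v‖ ^ 2 := Finset.sum_le_sum fun i _ => this i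
      _ = 4 * ‖v‖ ^ 2 := by simp
  have := hpos v₀ hv₀'
  calc Q v₀ / 4 * ∑ i, v i ^ 2 ≤ Q v₀ / 4 * (4 * ‖v‖ ^ 2) := by gcongr
    _ = Q v₀ * ‖v‖ ^ 2 := by ring
    _ ≤ Q v := h2

/-- The Gaussian `exp(πi/4 · ᵗz τ z)` on `ℤ⁴`. -/
def gauss (τ : Matrix (Fin 4) (Fin 4) ℂ) (z : Fin 4 → ℤ) : ℂ :=
  Complex.exp (Real.pi * Complex.I / 4 * ∑ i, ∑ j, (z i : ℂ) * τ i j * (z j : ℂ))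

theorem norm_gauss (τ : Matrix (Fin 4) (Fin 4) ℂ) (z : Fin 4 → ℤ) :
    ‖gauss τ z‖ = Real.exp (-(Real.pi / 4) * ∑ i, ∑ j, (z i : ℝ) * (τ i j).im * (z j : ℝ)) := by
  have h : (∑ i, ∑ j, (z i : ℂ) * τ i j * (z j : ℂ)).im =
      ∑ i, ∑ j, (z i : ℝ) * (τ i j).im * (z j : ℝ) := by
    simp [Complex.im_sum]
  rw [gauss, Complex.norm_exp, ← h]
  generalize (∑ i, ∑ j, (z i : ℂ) * τ i j * (z j : ℂ)) = s
  congr 1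
  have : (Real.pi * Complex.I / 4 * s : ℂ) = ((Real.pi / 4 : ℝ) : ℂ) * (Complex.I * s) := by
    push_cast; ring
  rw [this, Complex.re_ofReal_mul]
  simp

theorem summable_norm_gauss {τ : Matrix (Fin 4) (Fin 4) ℂ} (hτ : IsSiegel τ) :
    Summable fun z => ‖gauss τ z‖ := by
  obtain ⟨c, hc, h⟩ := exists_quadratic_lower_bound hτ.2
  have hs : Summable fun n : ℤ => ‖Real.exp (-(Real.pi / 4 * c) * (n : ℝ) ^ 2)‖ :=
    (summable_exp_neg_mul_sq (by positivity)).norm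
  refine Summable.of_nonneg_of_le (fun _ => norm_nonneg _) (fun z => ?_)
    (summable_norm_prod_pow hs 4).1
  rw [norm_gauss, ← Real.exp_sum, Real.norm_of_nonneg (Real.exp_pos _).le, Real.exp_le_exp,
    ← Finset.mul_sum]
  have := mul_le_mul_of_nonneg_left (h fun i => (z i : ℝ)) (by positivity : 0 ≤ Real.pi / 4)
  simp only [of_apply] at this
  linarith

theorem gauss_neg (τ : Matrix (Fin 4) (Fin 4) ℂ) (z : Fin 4 → ℤ) : gauss τ (-z) = gauss τ z := by
  simp [gauss]

theorem gauss_sub_mul_gauss_add (τ : Matrix (Fin 4) (Fin 4) ℂ) (u v : Fin 4 → ℤ) :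
    gauss τ (u - v) * gauss τ (u + v) = gauss τ u ^ 2 * gauss τ v ^ 2 := by
  simp only [gauss, ← Complex.exp_nat_mul, ← Complex.exp_add]
  congr 1
  have : ∑ i, ∑ j, (((u - v) i : ℤ) : ℂ) * τ i j * (((u - v) j : ℤ) : ℂ) +
      ∑ i, ∑ j, (((u + v) i : ℤ) : ℂ) * τ i j * (((u + v) j : ℤ) : ℂ) =
      2 * (∑ i, ∑ j, (u i : ℂ) * τ i j * (u j : ℂ) + ∑ i, ∑ j, (v i : ℂ) * τ i j * (v j : ℂ)) := by
    simp only [← Finset.sum_add_distrib, Finset.mul_sum]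
    refine Finset.sum_congr rfl fun i _ => Finset.sum_congr rfl fun j _ => ?_
    simp only [Pi.sub_apply, Pi.add_apply]
    push_cast
    ring
  push_cast at this ⊢
  linear_combination (Real.pi * Complex.I / 4 : ℂ) * this

/-- The class in `𝔽₂⁴` of an integer vector. -/
def parity (z : Fin 4 → ℤ) : Char4 := fun i => (z i : ZMod 2)

/-- The phase `exp(πi/2 · z·x)`. -/
def phase (z : Fin 4 → ℤ) (x : Char4) : ℂ := Complex.I ^ (∑ i, z i * ((x i).val : ℤ))

theorem phase_add (z w : Fin 4 → ℤ) (x : Char4) : phase (z + w) x = phase z x * phase w x := by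
  simp [phase, ← zpow_add₀ Complex.I_ne_zero, add_mul, Finset.sum_add_distrib]

theorem norm_phase (z : Fin 4 → ℤ) (x : Char4) : ‖phase z x‖ = 1 := by
  simp [phase]

theorem parity_add (z w : Fin 4 → ℤ) : parity (z + w) = parity z + parity w := by
  funext i; simp [parity]

theorem parity_neg (z : Fin 4 → ℤ) : parity (-z) = parity z := by
  funext i
  simp [parity, ZMod.neg_eq_self_mod_two]

theorem chi_parity (z : Fin 4 → ℤ) (x : Char4) :
    chi (parity z) x = (-1) ^ (∑ i, z i * ((x i).val : ℤ)) := by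
  have hz : ∀ (n : ℤ) (k : ℕ), (-1 : ℂ) ^ ((n : ZMod 2).val * k) = (-1) ^ (n * (k : ℤ)) := by
    intro n k
    rw [pow_mul, _root_.zpow_mul, zpow_natCast]
    congr 1
    rcases Int.even_or_odd n with h | h
    · rw [h.neg_one_zpow, (ZMod.intCast_eq_zero_iff_even).mpr h]; simp
    · rw [h.neg_one_zpow, (ZMod.intCast_eq_one_iff_odd).mpr h]; simp [ZMod.val_one]
  simp only [chi, parity, hz, Fin.prod_univ_four, Fin.sum_univ_four]
  simp only [zpow_add₀ (neg_ne_zero.mpr (one_ne_zero (α := ℂ)))]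

theorem phase_neg (z : Fin 4 → ℤ) (x : Char4) : phase (-z) x = chi (parity z) x * phase z x := by
  rw [chi_parity]
  simp only [phase, Pi.neg_apply, neg_mul, Finset.sum_neg_distrib]
  generalize ∑ i, z i * ((x i).val : ℤ) = n
  rw [← mul_zpow, _root_.zpow_neg, ← _root_.inv_zpow]
  simp

theorem phase_sub_mul_phase_add (u v : Fin 4 → ℤ) (x : Char4) :
    phase (u - v) x * phase (u + v) x = chi (parity u) x := by
  rw [← phase_add, chi_parity, sub_add_add_cancel, phase_add, phase, ← mul_zpow, Complex.I_mul_I]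

theorem I_zpow_eq_exp (n : ℤ) : Complex.I ^ n = Complex.exp (n * (Real.pi / 2 * Complex.I)) := by
  rw [Complex.exp_int_mul, Complex.exp_pi_div_two_mul_I]

/-- The sum of `f` over a parity class, twisted by a phase. -/
def thetaSum (f : (Fin 4 → ℤ) → ℂ) (ε x : Char4) : ℂ :=
  ∑' z, if parity z = ε then f z * phase z x else 0

theorem summable_norm_thetaSum {f : (Fin 4 → ℤ) → ℂ} (hf : Summable fun z => ‖f z‖)
    (ε x : Char4) : Summable fun z => ‖if parity z = ε then f z * phase z x else 0‖ := by
  refine Summable.of_nonneg_of_le (fun _ => norm_nonneg _) (fun z => ?_) hf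
  split_ifs
  · rw [norm_mul, norm_phase, mul_one]
  · rw [norm_zero]; exact norm_nonneg _

theorem thetaSum_eq_chi_mul {f : (Fin 4 → ℤ) → ℂ} (hf : ∀ z, f (-z) = f z) (ε x : Char4) :
    thetaSum f ε x = chi ε x * thetaSum f ε x := by
  conv_lhs => rw [thetaSum, ← (Equiv.neg (Fin 4 → ℤ)).tsum_eq]
  rw [thetaSum, ← tsum_mul_left]
  refine tsum_congr fun z => ?_
  simp only [Equiv.neg_apply, parity_neg, hf, phase_neg]
  split_ifs with h
  · rw [h]; ring
  · rw [mul_zero]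

theorem phase_add_right (z : Fin 4 → ℤ) (x y : Char4) :
    phase z (x + y) = phase z x * phase z y * chi (parity z * x) y := by
  have hI : ∀ (n : ℤ) (a b : ZMod 2), Complex.I ^ (n * ((a + b).val : ℤ)) =
      Complex.I ^ (n * (a.val : ℤ)) * Complex.I ^ (n * (b.val : ℤ)) *
        (-1) ^ (((n : ZMod 2) * a).val * b.val) := by
    intro n a b
    have two : ∀ y : ZMod 2, y = 0 ∨ y = 1 := by decide
    rcases two a with rfl | rfl
    · simp
    rcases two b with rfl | rfl
    · simp
    have h2 : (1 + 1 : ZMod 2) = 0 := rfl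
    rw [h2]
    simp only [ZMod.val_zero, ZMod.val_one, Nat.cast_zero, Nat.cast_one, mul_zero, mul_one,
      zpow_zero, ← mul_zpow, Complex.I_mul_I]
    rcases Int.even_or_odd n with h | h
    · rw [h.neg_one_zpow, (ZMod.intCast_eq_zero_iff_even).mpr h]; simp
    · rw [h.neg_one_zpow, (ZMod.intCast_eq_one_iff_odd).mpr h]; simp [ZMod.val_one]
  have hp : ∀ y : Char4, phase z y = ∏ i, Complex.I ^ (z i * ((y i).val : ℤ)) := by
    intro y
    simp only [phase, Fin.prod_univ_four, Fin.sum_univ_four, zpow_add₀ Complex.I_ne_zero]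
  rw [hp, hp, hp, chi, ← Finset.prod_mul_distrib, ← Finset.prod_mul_distrib]
  exact Finset.prod_congr rfl fun i _ => hI (z i) (x i) (y i)

theorem exists_sub_add {z w : Fin 4 → ℤ} (h : parity z = parity w) :
    ∃ u v : Fin 4 → ℤ, u - v = z ∧ u + v = w := by
  have hd : ∀ i, ∃ k, w i - z i = 2 * k := fun i => by
    have := congrFun h i
    simp only [parity] at this
    exact (ZMod.intCast_eq_intCast_iff_dvd_sub _ _ 2).mp this
  choose k hk using hd
  refine ⟨z + k, k, by simp, ?_⟩
  funext i
  have := hk i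
  simp only [Pi.add_apply]
  omega

theorem thetaSum_mul {f g : (Fin 4 → ℤ) → ℂ} (hf : Summable fun z => ‖f z‖)
    (hg : Summable fun z => ‖g z‖) (hfg : ∀ u v, f (u - v) * f (u + v) = g u * g v)
    (β ε x : Char4) :
    thetaSum f ε x * thetaSum f ε (x + β) =
      chi (ε * x) β * ∑ σ, chi σ x * (thetaSum g σ β * thetaSum g (σ + ε) β) := by
  have hL : thetaSum f ε x * thetaSum f ε (x + β) = ∑' q : (Fin 4 → ℤ) × (Fin 4 → ℤ),
      if parity (q.1 + q.2) = ε then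
        chi (ε * x) β * (chi (parity q.1) x * (g q.1 * phase q.1 β * (g q.2 * phase q.2 β)))
      else 0 := by
    rw [thetaSum, thetaSum, tsum_mul_tsum_of_summable_norm (summable_norm_thetaSum hf _ _)
      (summable_norm_thetaSum hf _ _)]
    have hinj : Function.Injective fun q : (Fin 4 → ℤ) × (Fin 4 → ℤ) =>
        (q.1 - q.2, q.1 + q.2) := by
      rintro ⟨u, v⟩ ⟨u', v'⟩ h
      simp only [Prod.mk.injEq] at h
      have h1 : ∀ i, u i - v i = u' i - v' i := congrFun h.1
      have h2 : ∀ i, u i + v i = u' i + v' i := congrFun h.2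
      ext i
      · have := h1 i; have := h2 i; simp only; omega
      · have := h1 i; have := h2 i; simp only; omega
    rw [← hinj.tsum_eq]
    · refine tsum_congr fun q => ?_
      obtain ⟨u, v⟩ := q
      have hp : parity (u - v) = parity (u + v) := by
        rw [sub_eq_add_neg, parity_add, parity_add, parity_neg]
      simp only [hp]
      split_ifs with h
      · rw [phase_add_right (u + v), h, ← phase_sub_mul_phase_add u v x, phase_add u v β]
        linear_combination (phase (u - v) x * phase (u + v) x * (phase u β * phase v β) *
          chi (ε * x) β) * hfg u v
      · rw [mul_zero]
    · rintro ⟨z, w⟩ hzw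
      have hz : parity z = ε := by
        by_contra hne
        exact hzw (by simp [hne])
      have hw : parity w = ε := by
        by_contra hne
        exact hzw (by simp [hne])
      obtain ⟨u, v, rfl, rfl⟩ := exists_sub_add (hz.trans hw.symm)
      exact ⟨(u, v), rfl⟩
  let G : Char4 → (Fin 4 → ℤ) → ℂ := fun σ z => if parity z = σ then g z * phase z β else 0
  have hG : ∀ σ, Summable fun z => ‖G σ z‖ := fun σ => summable_norm_thetaSum hg σ β
  have hs : ∀ σ, Summable fun q : (Fin 4 → ℤ) × (Fin 4 → ℤ) => G σ q.1 * G (σ + ε) q.2 :=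
    fun σ => summable_mul_of_summable_norm (hG σ) (hG (σ + ε))
  have hR : ∀ σ, thetaSum g σ β * thetaSum g (σ + ε) β =
      ∑' q : (Fin 4 → ℤ) × (Fin 4 → ℤ), G σ q.1 * G (σ + ε) q.2 :=
    fun σ => tsum_mul_tsum_of_summable_norm (hG σ) (hG (σ + ε))
  have hsum := Summable.tsum_finsetSum (s := Finset.univ)
    fun σ _ => (hs σ).mul_left (chi σ x)
  simp only [tsum_mul_left, ← hR] at hsum
  rw [hL, ← hsum, ← tsum_mul_left]
  refine tsum_congr fun q => ?_
  rw [Finset.sum_eq_single (parity q.1)]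
  · have : parity (q.1 + q.2) = ε ↔ parity q.2 = parity q.1 + ε := by
      rw [parity_add]
      constructor
      · rintro rfl
        rw [← add_assoc, char4_add_self, zero_add]
      · intro h
        rw [h, ← add_assoc, char4_add_self, zero_add]
    simp only [G, this, if_true]
    split_ifs <;> ring
  · intro σ _ hσ
    simp only [G]
    rw [if_neg hσ.symm, zero_mul, mul_zero]
  · simp

theorem thetaConst_eq_thetaSum (τ : Matrix (Fin 4) (Fin 4) ℂ) (ε x : Char4) :
    thetaConst 4 ε x τ = thetaSum (gauss τ) ε x := by
  set φ : (Fin 4 → ℤ) → Fin 4 → ℤ := fun m i => 2 * m i + ((ε i).val : ℤ) with hφ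
  have hinj : Function.Injective φ := by
    intro m m' h
    funext i
    have := congrFun h i
    simp only [hφ] at this
    omega
  have hpar : ∀ m, parity (φ m) = ε := by
    intro m
    funext i
    have h2 : (2 : ZMod 2) = 0 := rfl
    simp [parity, hφ, h2]
  rw [thetaSum, ← hinj.tsum_eq]
  · refine tsum_congr fun m => ?_
    rw [if_pos (hpar m), gauss, phase, I_zpow_eq_exp, ← Complex.exp_add]
    congr 1
    have hv : ∀ y : ZMod 2, ((Fin.val (n := 2) y : ℕ) : ℂ) = ((y.val : ℕ) : ℂ) := fun _ => rfl
    simp only [hφ, hv, Fin.sum_univ_four]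
    push_cast
    ring
  · intro z hz
    have h : parity z = ε := by
      by_contra hne
      exact hz (if_neg hne)
    have hd : ∀ i, ∃ k, z i - ((ε i).val : ℤ) = 2 * k := fun i => by
      have := congrFun h.symm i
      refine (ZMod.intCast_eq_intCast_iff_dvd_sub _ _ 2).mp ?_
      simpa [parity] using this
    choose k hk using hd
    refine ⟨k, ?_⟩
    funext i
    have := hk i
    simp only [hφ]
    omega

theorem phase_sum {N : ℕ} (z : Fin N → Fin 4 → ℤ) (x : Char4) :
    ∏ i, phase (z i) x = phase (∑ i, z i) x := by
  let φ : Multiplicative (Fin 4 → ℤ) →* ℂ :=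
    { toFun := fun z => phase z.toAdd x
      map_one' := by simp [phase]
      map_mul' := fun a b => phase_add a.toAdd b.toAdd x }
  exact (map_prod φ (fun i => Multiplicative.ofAdd (z i)) Finset.univ).symm

/-- The integer vectors whose entries are all congruent modulo 2 and whose sum is divisible by 4,
that is, twice the lattice `D_N ∪ (D_N + (1/2, …, 1/2))` when 8 divides `N`. -/
def doubledLattice (N : ℕ) : Set (Fin N → ℤ) :=
  {w | (∀ i k, (2 : ℤ) ∣ w i - w k) ∧ 4 ∣ ∑ i, w i}

/-- The theta series of `doubledLattice N`, in genus 4. -/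
def latticeSum (N : ℕ) (f : (Fin 4 → ℤ) → ℂ) : ℂ :=
  ∑' z : Fin N → Fin 4 → ℤ,
    Set.indicator {z | ∀ j, (fun i => z i j) ∈ doubledLattice N} (fun z => ∏ i, f (z i)) z

theorem sum_sum_prod_thetaSum_term {N : ℕ} (hN : Even N) (hN' : 0 < N) (f : (Fin 4 → ℤ) → ℂ)
    (z : Fin N → Fin 4 → ℤ) :
    ∑ ε, ∑ x, ∏ i, (if parity (z i) = ε then f (z i) * phase (z i) x else 0) =
      16 * Set.indicator {z | ∀ j, (fun i => z i j) ∈ doubledLattice N}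
        (fun z => ∏ i, f (z i)) z := by
  have hpar : ∀ i k j, parity (z i) j = parity (z k) j ↔ (2 : ℤ) ∣ z i j - z k j := by
    intro i k j
    rw [eq_comm]
    exact ZMod.intCast_eq_intCast_iff_dvd_sub _ _ 2
  set i₀ : Fin N := ⟨0, hN'⟩
  by_cases h : ∀ i, parity (z i) = parity (z i₀)
  · rw [Finset.sum_eq_single (parity (z i₀))]
    · simp only [h, if_true, Finset.prod_mul_distrib, phase_sum, ← Finset.mul_sum]
      have heven : ∀ j, Even (∑ i, z i j) := by
        intro j
        rw [← ZMod.intCast_eq_zero_iff_even]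
        push_cast
        have : ∀ i, (z i j : ZMod 2) = parity (z i₀) j := fun i => congrFun (h i) j
        simp only [this, Finset.sum_const, Finset.card_univ, Fintype.card_fin, nsmul_eq_mul]
        rw [(ZMod.natCast_eq_zero_iff_even).mpr hN, zero_mul]
      choose k hk using heven
      have hk' : ∑ i, z i = k + k := by
        funext j
        rw [Finset.sum_apply, hk j, Pi.add_apply]
      have hphase : ∀ x, phase (k + k) x = chi (parity k) x := fun x => by
        rw [← phase_sub_mul_phase_add k k x, sub_self]
        simp [phase]
      simp only [hk', hphase, sum_chi]
      have hiff : parity k = 0 ↔ z ∈ {z | ∀ j, (fun i => z i j) ∈ doubledLattice N} := by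
        simp only [doubledLattice, Set.mem_ofPred_eq]
        constructor
        · intro h0 j
          refine ⟨fun i l => (hpar i l j).mp (by rw [h i, h l]), ?_⟩
          have : Even (k j) := (ZMod.intCast_eq_zero_iff_even).mp (congrFun h0 j)
          rw [hk j]
          obtain ⟨r, hr⟩ := this
          exact ⟨r, by omega⟩
        · intro h0
          funext j
          refine (ZMod.intCast_eq_zero_iff_even).mpr ?_
          obtain ⟨r, hr⟩ := (h0 j).2
          rw [hk j] at hr
          exact ⟨r, by omega⟩
      by_cases h0 : parity k = 0
      · rw [if_pos h0, Set.indicator_of_mem (hiff.mp h0), mul_comm]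
      · rw [if_neg h0, Set.indicator_of_notMem (fun hm => h0 (hiff.mpr hm)), mul_zero, mul_zero]
    · intro ε _ hε
      refine Finset.sum_eq_zero fun x _ => Finset.prod_eq_zero (Finset.mem_univ i₀) ?_
      rw [if_neg hε.symm]
    · simp
  · rw [Set.indicator_of_notMem, mul_zero]
    · refine Finset.sum_eq_zero fun ε _ => Finset.sum_eq_zero fun x _ => ?_
      by_contra hne
      refine h fun i => ?_
      have : ∀ i, parity (z i) = ε := fun i => by
        by_contra hi
        exact hne (Finset.prod_eq_zero (Finset.mem_univ i) (if_neg hi))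
      rw [this, this]
    · intro hm
      exact h fun i => funext fun j => (hpar i i₀ j).mpr ((hm j).1 i i₀)

theorem sum_sum_thetaSum_pow {N : ℕ} (hN : Even N) (hN' : 0 < N) {f : (Fin 4 → ℤ) → ℂ}
    (hf : Summable fun z => ‖f z‖) :
    ∑ ε, ∑ x, thetaSum f ε x ^ N = 16 * latticeSum N f := by
  have hF : ∀ ε x, thetaSum f ε x ^ N = ∑' z : Fin N → Fin 4 → ℤ,
      ∏ i, (if parity (z i) = ε then f (z i) * phase (z i) x else 0) := fun ε x =>
    (summable_norm_prod_pow (summable_norm_thetaSum hf ε x) N).2.symm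
  have hS : ∀ ε x, Summable fun z : Fin N → Fin 4 → ℤ =>
      ∏ i, (if parity (z i) = ε then f (z i) * phase (z i) x else 0) := fun ε x =>
    (summable_norm_prod_pow (summable_norm_thetaSum hf ε x) N).1.of_norm
  simp only [hF]
  have h1 : ∀ ε, ∑ x, ∑' z : Fin N → Fin 4 → ℤ,
      ∏ i, (if parity (z i) = ε then f (z i) * phase (z i) x else 0) =
        ∑' z : Fin N → Fin 4 → ℤ,
          ∑ x, ∏ i, (if parity (z i) = ε then f (z i) * phase (z i) x else 0) := fun ε =>
    (Summable.tsum_finsetSum fun x _ => hS ε x).symm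
  simp only [h1]
  rw [← Summable.tsum_finsetSum fun ε _ => summable_sum fun x _ => hS ε x, latticeSum,
    ← tsum_mul_left]
  exact tsum_congr (sum_sum_prod_thetaSum_term hN hN' f)

theorem prod_gauss {N : ℕ} (τ : Matrix (Fin 4) (Fin 4) ℂ) (z : Matrix (Fin N) (Fin 4) ℤ) :
    ∏ i, gauss τ (z i) = Complex.exp (Real.pi * Complex.I / 4 *
      trace ((z.map (Int.cast : ℤ → ℂ))ᵀ * z.map (Int.cast : ℤ → ℂ) * τ)) := by
  simp only [gauss, ← Complex.exp_sum, ← Finset.mul_sum]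
  congr 2
  simp only [trace, diag_apply, mul_apply, transpose_apply, map_apply, Finset.sum_mul]
  rw [Finset.sum_congr rfl fun i _ => Finset.sum_comm, Finset.sum_comm]
  refine Finset.sum_congr rfl fun a _ => ?_
  rw [Finset.sum_comm]
  exact Finset.sum_congr rfl fun b _ => Finset.sum_congr rfl fun i _ => by ring

theorem prod_gauss_mul {N : ℕ} {S A : Matrix (Fin N) (Fin N) ℤ} (hA : Aᵀ * A = (4 : ℤ) • S)
    (τ : Matrix (Fin 4) (Fin 4) ℂ) (G : Matrix (Fin N) (Fin 4) ℤ) :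
    ∏ i, gauss τ ((A * G) i) = Complex.exp ((Real.pi : ℂ) * Complex.I *
      Matrix.trace ((G.map (Int.cast : ℤ → ℂ))ᵀ * S.map (Int.cast : ℤ → ℂ) *
        G.map (Int.cast : ℤ → ℂ) * τ)) := by
  have hA' : (A.map (Int.cast : ℤ → ℂ))ᵀ * A.map (Int.cast : ℤ → ℂ) =
      (4 : ℂ) • S.map (Int.cast : ℤ → ℂ) := by
    have := congrArg (fun M : Matrix (Fin N) (Fin N) ℤ => M.map (Int.cast : ℤ → ℂ)) hA
    simp only [Matrix.map_mul_intCast, ← transpose_map] at this ⊢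
    rw [this]
    ext i j
    simp only [map_apply, Matrix.smul_apply, smul_eq_mul]
    push_cast
    rfl
  have hz : (A * G).map (Int.cast : ℤ → ℂ) = A.map (Int.cast : ℤ → ℂ) * G.map (Int.cast : ℤ → ℂ) :=
    Matrix.map_mul (f := Int.castRingHom ℂ)
  rw [prod_gauss, hz, transpose_mul]
  rw [Matrix.mul_assoc (G.map _)ᵀ, ← Matrix.mul_assoc _ (A.map _), hA']
  congr 1
  rw [Matrix.smul_mul, Matrix.mul_smul, Matrix.smul_mul, trace_smul, smul_eq_mul]
  rw [Matrix.mul_assoc (G.map _)ᵀ (S.map _)]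
  ring

theorem mul_injective_of_mulVec_injective {N : ℕ} {A : Matrix (Fin N) (Fin N) ℤ}
    (hinj : Function.Injective A.mulVec) :
    Function.Injective fun G : Matrix (Fin N) (Fin 4) ℤ => A * G := by
  intro G H h
  have : ∀ j, (fun i => G i j) = fun i => H i j := fun j =>
    hinj (funext fun i => congrFun (congrFun h i) j)
  ext i j
  exact congrFun (this j) i

theorem quadThetaSeries_eq_latticeSum {N : ℕ} {S A : Matrix (Fin N) (Fin N) ℤ}
    (hA : Aᵀ * A = (4 : ℤ) • S) (hinj : Function.Injective A.mulVec)
    (hrange : Set.range A.mulVec = doubledLattice N) (τ : Matrix (Fin 4) (Fin 4) ℂ) :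
    quadThetaSeries N 4 S τ = latticeSum N (gauss τ) := by
  let Φ : Matrix (Fin N) (Fin 4) ℤ → Fin N → Fin 4 → ℤ := fun G => A * G
  have hΦ : Function.Injective Φ := mul_injective_of_mulVec_injective hinj
  have hmem : ∀ z : Fin N → Fin 4 → ℤ, (∀ j, (fun i => z i j) ∈ doubledLattice N) ↔
      z ∈ Set.range Φ := by
    intro z
    simp only [← hrange]
    constructor
    · intro h
      choose g hg using h
      exact ⟨fun i j => g j i, funext fun i => funext fun j => congrFun (hg j) i⟩
    · rintro ⟨G, rfl⟩ j
      exact ⟨fun i => G i j, rfl⟩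
  rw [latticeSum, ← hΦ.tsum_eq]
  · refine tsum_congr fun G => ?_
    have hG : Φ G ∈ {z : Fin N → Fin 4 → ℤ | ∀ j, (fun i => z i j) ∈ doubledLattice N} :=
      (hmem _).mpr ⟨G, rfl⟩
    exact ((Set.indicator_of_mem hG _).trans (prod_gauss_mul hA τ G)).symm
  · intro z hz
    exact (hmem z).mp (Set.mem_of_indicator_ne_zero hz)

/-- The doubled coordinates of the simple roots of `E₈`, as columns. -/
def E8Basis : Matrix (Fin 8) (Fin 8) ℤ :=
  !![1, -2, 0, 0, 0, 0, 0, 2;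
    -1, 2, -2, 0, 0, 0, 0, 2;
    -1, 0, 2, -2, 0, 0, 0, 0;
    -1, 0, 0, 2, -2, 0, 0, 0;
    -1, 0, 0, 0, 2, -2, 0, 0;
    -1, 0, 0, 0, 0, 2, -2, 0;
    -1, 0, 0, 0, 0, 0, 2, 0;
    1, 0, 0, 0, 0, 0, 0, 0]

theorem E8Basis_gram : E8Basisᵀ * E8Basis = (4 : ℤ) • E8Gram := by
  ext i j
  revert i j
  decide +kernel

theorem E8Basis_mulVec (g : Fin 8 → ℤ) : E8Basis *ᵥ g =
    ![g 0 - 2 * g 1 + 2 * g 7, -g 0 + 2 * g 1 - 2 * g 2 + 2 * g 7, -g 0 + 2 * g 2 - 2 * g 3,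
      -g 0 + 2 * g 3 - 2 * g 4, -g 0 + 2 * g 4 - 2 * g 5, -g 0 + 2 * g 5 - 2 * g 6,
      -g 0 + 2 * g 6, g 0] := by
  funext i
  fin_cases i <;> simp [E8Basis, mulVec, dotProduct, Fin.sum_univ_eight] <;> ring

theorem E8Basis_mulVec_injective : Function.Injective E8Basis.mulVec := by
  intro g g' h
  rw [E8Basis_mulVec, E8Basis_mulVec] at h
  simp only [vecCons_inj] at h
  obtain ⟨h0, h1, h2, h3, h4, h5, h6, h7, -⟩ := h
  have e0 : g 0 = g' 0 := by lia
  have e6 : g 6 = g' 6 := by lia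
  have e5 : g 5 = g' 5 := by lia
  have e4 : g 4 = g' 4 := by lia
  have e3 : g 3 = g' 3 := by lia
  have e2 : g 2 = g' 2 := by lia
  have e1 : g 1 = g' 1 := by lia
  have e7 : g 7 = g' 7 := by lia
  funext i
  fin_cases i
  exacts [e0, e1, e2, e3, e4, e5, e6, e7]

theorem mem_doubledLattice_of_eq_add {N : ℕ} {w k : Fin N → ℤ} {a m : ℤ}
    (h : ∀ i, w i = a + 2 * k i) (hm : ∑ i, w i = 4 * m) : w ∈ doubledLattice N :=
  ⟨fun i l => ⟨k i - k l, by rw [h i, h l]; ring⟩, m, hm⟩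

theorem range_E8Basis : Set.range E8Basis.mulVec = doubledLattice 8 := by
  ext w
  constructor
  · rintro ⟨g, rfl⟩
    refine mem_doubledLattice_of_eq_add (a := g 0) (k := ![-g 1 + g 7,
      -g 0 + g 1 - g 2 + g 7, -g 0 + g 2 - g 3, -g 0 + g 3 - g 4, -g 0 + g 4 - g 5,
      -g 0 + g 5 - g 6, -g 0 + g 6, 0]) (m := g 7 - g 0) (fun i => ?_) ?_
    · rw [E8Basis_mulVec]
      fin_cases i <;> simp <;> ring
    · rw [E8Basis_mulVec]
      simp [Fin.sum_univ_eight]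
      ring
  · rintro ⟨h, m, hm⟩
    choose k hk using fun i => h i 7
    simp only [Fin.sum_univ_eight] at hm
    refine ⟨![w 7, w 7 + m - k 0, 5 * w 7 + (k 2 + k 3 + k 4 + k 5 + k 6),
      4 * w 7 + (k 3 + k 4 + k 5 + k 6), 3 * w 7 + (k 4 + k 5 + k 6), 2 * w 7 + (k 5 + k 6),
      w 7 + k 6, w 7 + m], ?_⟩
    rw [E8Basis_mulVec]
    have h0 := hk 0
    have h1 := hk 1
    have h2 := hk 2
    have h3 := hk 3
    have h4 := hk 4
    have h5 := hk 5
    have h6 := hk 6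
    funext i
    fin_cases i <;> simp <;> omega

/-- The doubled coordinates of the basis `2e₁, e₂ - e₁, …, e₁₅ - e₁₄, (1/2, …, 1/2)` of `D₁₆⁺`,
as columns. -/
def D16plusBasis : Matrix (Fin 16) (Fin 16) ℤ := fun i j =>
  if j = 15 then 1
  else if i = j then (if i = 0 then 4 else 2)
  else if i.val + 1 = j.val then -2
  else 0

theorem D16plusBasis_gram : D16plusBasisᵀ * D16plusBasis = (4 : ℤ) • D16plusGram := by
  ext i j
  revert i j
  decide +kernel

theorem fin_sum_univ_sixteen (f : Fin 16 → ℤ) :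
    ∑ i, f i = f 0 + f 1 + f 2 + f 3 + f 4 + f 5 + f 6 + f 7 + f 8 + f 9 + f 10 + f 11 + f 12 +
      f 13 + f 14 + f 15 := by
  simp only [Fin.sum_univ_castSucc, Fin.sum_univ_zero, zero_add]
  rfl

theorem D16plusBasis_mulVec (g : Fin 16 → ℤ) : D16plusBasis *ᵥ g =
    ![4 * g 0 - 2 * g 1 + g 15, 2 * g 1 - 2 * g 2 + g 15, 2 * g 2 - 2 * g 3 + g 15,
      2 * g 3 - 2 * g 4 + g 15, 2 * g 4 - 2 * g 5 + g 15, 2 * g 5 - 2 * g 6 + g 15,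
      2 * g 6 - 2 * g 7 + g 15, 2 * g 7 - 2 * g 8 + g 15, 2 * g 8 - 2 * g 9 + g 15,
      2 * g 9 - 2 * g 10 + g 15, 2 * g 10 - 2 * g 11 + g 15, 2 * g 11 - 2 * g 12 + g 15,
      2 * g 12 - 2 * g 13 + g 15, 2 * g 13 - 2 * g 14 + g 15, 2 * g 14 + g 15, g 15] := by
  funext i
  simp only [mulVec, dotProduct, fin_sum_univ_sixteen, D16plusBasis]
  fin_cases i <;> simp <;> ring

theorem D16plusBasis_mulVec_injective : Function.Injective D16plusBasis.mulVec := by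
  intro g g' h
  rw [D16plusBasis_mulVec, D16plusBasis_mulVec] at h
  simp only [vecCons_inj] at h
  obtain ⟨h0, h1, h2, h3, h4, h5, h6, h7, h8, h9, h10, h11, h12, h13, h14, h15, -⟩ := h
  have e15 : g 15 = g' 15 := by lia
  have e14 : g 14 = g' 14 := by lia
  have e13 : g 13 = g' 13 := by lia
  have e12 : g 12 = g' 12 := by lia
  have e11 : g 11 = g' 11 := by lia
  have e10 : g 10 = g' 10 := by lia
  have e9 : g 9 = g' 9 := by lia
  have e8 : g 8 = g' 8 := by lia
  have e7 : g 7 = g' 7 := by lia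
  have e6 : g 6 = g' 6 := by lia
  have e5 : g 5 = g' 5 := by lia
  have e4 : g 4 = g' 4 := by lia
  have e3 : g 3 = g' 3 := by lia
  have e2 : g 2 = g' 2 := by lia
  have e1 : g 1 = g' 1 := by lia
  have e0 : g 0 = g' 0 := by lia
  funext i
  fin_cases i
  exacts [e0, e1, e2, e3, e4, e5, e6, e7, e8, e9, e10, e11, e12, e13, e14, e15]

theorem range_D16plusBasis : Set.range D16plusBasis.mulVec = doubledLattice 16 := by
  ext w
  constructor
  · rintro ⟨g, rfl⟩
    refine mem_doubledLattice_of_eq_add (a := g 15) (k := ![2 * g 0 - g 1, g 1 - g 2, g 2 - g 3, g 3 - g 4, g 4 - g 5, g 5 - g 6, g 6 - g 7, g 7 - g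
      8, g 8 - g 9, g 9 - g 10, g 10 - g 11, g 11 - g 12, g 12 - g 13, g 13 - g 14, g 14,
      0])
      (m := g 0 + 4 * g 15) (fun i => ?_) ?_
    · rw [D16plusBasis_mulVec]
      fin_cases i <;> simp <;> ring
    · rw [D16plusBasis_mulVec, fin_sum_univ_sixteen]
      simp only [cons_val]
      ring
  · rintro ⟨h, m, hm⟩
    choose k hk using fun i => h i 15
    rw [fin_sum_univ_sixteen] at hm
    refine ⟨![m - 4 * w 15, k 1 + k 2 + k 3 + k 4 + k 5 + k 6 + k 7 + k 8 + k 9 + k 10 + k 11 + k 12 + k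
      13 + k 14, k 2 + k 3 + k 4 + k 5 + k 6 + k 7 + k 8 + k 9 + k 10 + k 11 + k 12 + k 13
      + k 14, k 3 + k 4 + k 5 + k 6 + k 7 + k 8 + k 9 + k 10 + k 11 + k 12 + k 13 + k 14,
      k 4 + k 5 + k 6 + k 7 + k 8 + k 9 + k 10 + k 11 + k 12 + k 13 + k 14, k 5 + k 6 + k
      7 + k 8 + k 9 + k 10 + k 11 + k 12 + k 13 + k 14, k 6 + k 7 + k 8 + k 9 + k 10 + k
      11 + k 12 + k 13 + k 14, k 7 + k 8 + k 9 + k 10 + k 11 + k 12 + k 13 + k 14, k 8 + k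
      9 + k 10 + k 11 + k 12 + k 13 + k 14, k 9 + k 10 + k 11 + k 12 + k 13 + k 14, k 10 +
      k 11 + k 12 + k 13 + k 14, k 11 + k 12 + k 13 + k 14, k 12 + k 13 + k 14, k 13 + k
      14, k 14, w 15], ?_⟩
    rw [D16plusBasis_mulVec]
    have hsum : k 0 + k 1 + k 2 + k 3 + k 4 + k 5 + k 6 + k 7 + k 8 + k 9 + k 10 + k 11 + k 12 + k 13 + k 14 = 2 * m - 8 * w 15 := by
      linarith [hk 0, hk 1, hk 2, hk 3, hk 4, hk 5, hk 6, hk 7, hk 8, hk 9, hk 10, hk 11, hk 12, hk 13, hk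
        14]
    funext i
    have hi := hk i
    fin_cases i <;> simp only [Fin.reduceFinMk, cons_val] at hi ⊢ <;> linarith

theorem summable_norm_quadThetaSeries_term {N : ℕ} {S A : Matrix (Fin N) (Fin N) ℤ}
    (hA : Aᵀ * A = (4 : ℤ) • S) (hinj : Function.Injective A.mulVec)
    {τ : Matrix (Fin 4) (Fin 4) ℂ} (hτ : IsSiegel τ) :
    Summable fun G : Matrix (Fin N) (Fin 4) ℤ => ‖Complex.exp ((Real.pi : ℂ) * Complex.I *
      Matrix.trace ((G.map (Int.cast : ℤ → ℂ))ᵀ * S.map (Int.cast : ℤ → ℂ) *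
        G.map (Int.cast : ℤ → ℂ) * τ))‖ := by
  let Φ : Matrix (Fin N) (Fin 4) ℤ → Fin N → Fin 4 → ℤ := fun G => A * G
  have hΦ : Function.Injective Φ := mul_injective_of_mulVec_injective hinj
  refine ((summable_norm_prod_pow (summable_norm_gauss hτ) N).1.comp_injective hΦ).congr
    fun G => ?_
  exact congrArg norm (prod_gauss_mul hA τ G)

theorem quadThetaSeries_E8E8Gram {τ : Matrix (Fin 4) (Fin 4) ℂ} (hτ : IsSiegel τ) :
    quadThetaSeries 16 4 E8E8Gram τ = quadThetaSeries 8 4 E8Gram τ ^ 2 := by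
  have hs := summable_norm_quadThetaSeries_term E8Basis_gram E8Basis_mulVec_injective hτ
  let e : Matrix (Fin 8) (Fin 4) ℤ × Matrix (Fin 8) (Fin 4) ℤ ≃ Matrix (Fin 16) (Fin 4) ℤ :=
    (Equiv.sumArrowEquivProdArrow (Fin 8) (Fin 8) (Fin 4 → ℤ)).symm.trans
      (Equiv.arrowCongr finSumFinEquiv (Equiv.refl _))
  have heq : ∀ q i, e q (finSumFinEquiv i) = Sum.elim q.1 q.2 i := fun q i =>
    congrArg (Sum.elim q.1 q.2) (finSumFinEquiv.symm_apply_apply i)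
  have he : ∀ q, (e q).map (Int.cast : ℤ → ℂ) =
      (fromRows (q.1.map (Int.cast : ℤ → ℂ)) (q.2.map (Int.cast : ℤ → ℂ))).submatrix
        finSumFinEquiv.symm id := by
    intro q
    ext i j
    obtain ⟨i, rfl⟩ := (finSumFinEquiv (m := 8) (n := 8)).surjective i
    rw [submatrix_apply, Equiv.symm_apply_apply, map_apply, heq]
    rcases i with i | i <;> rfl
  have hE : E8E8Gram.map (Int.cast : ℤ → ℂ) =
      (fromBlocks (E8Gram.map (Int.cast : ℤ → ℂ)) 0 0 (E8Gram.map (Int.cast : ℤ → ℂ))).submatrix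
        finSumFinEquiv.symm finSumFinEquiv.symm := by
    ext i j
    obtain ⟨i, rfl⟩ := (finSumFinEquiv (m := 8) (n := 8)).surjective i
    obtain ⟨j, rfl⟩ := (finSumFinEquiv (m := 8) (n := 8)).surjective j
    rcases i with i | i <;> rcases j with j | j <;> simp [E8E8Gram]
  rw [sq, quadThetaSeries, quadThetaSeries, tsum_mul_tsum_of_summable_norm hs hs, ← e.tsum_eq]
  refine tsum_congr fun q => ?_
  rw [← Complex.exp_add, ← mul_add, he, hE, transpose_submatrix, submatrix_mul_equiv,
    submatrix_mul_equiv, submatrix_id_id, transpose_fromRows, fromCols_mul_fromBlocks,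
    fromCols_mul_fromRows, Matrix.add_mul, trace_add]
  simp

theorem p_eq_thetaSum_mul (τ : Matrix (Fin 4) (Fin 4) ℂ) (a b c x y z : ZMod 2) :
    p ![a, b, c] ![x, y, z] τ = thetaSum (gauss τ) ![a, b, c, 0] ![x, y, z, 0] *
      thetaSum (gauss τ) ![a, b, c, 0] ![x, y, z, 1] := by
  have hsnoc : ∀ (a b c d : ZMod 2),
      (Fin.snoc (α := fun _ => Fin 2) ![a, b, c] d : Fin 4 → Fin 2) = (![a, b, c, d] : Char4) := by
    intro a b c d
    funext i
    fin_cases i <;> rfl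
  rw [← thetaConst_eq_thetaSum, ← thetaConst_eq_thetaSum, ← hsnoc, ← hsnoc, ← hsnoc]
  rfl

theorem prod_p_eq_octad (τ : Matrix (Fin 4) (Fin 4) ℂ) (c z : ZMod 2) :
    octad (thetaSum (gauss τ)) ![1, 0, 0, 0] ![0, 1, 0, 0] ![0, 0, 0, 1] ![0, 0, c, 0]
      ![0, 0, z, 0] =
    p ![(0 : ZMod 2), (0 : ZMod 2), c] ![(0 : ZMod 2), (0 : ZMod 2), z] τ *
      p ![(0 : ZMod 2), (0 : ZMod 2), c] ![(1 : ZMod 2), (0 : ZMod 2), z] τ *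
      p ![(0 : ZMod 2), (0 : ZMod 2), c] ![(0 : ZMod 2), (1 : ZMod 2), z] τ *
      p ![(0 : ZMod 2), (0 : ZMod 2), c] ![(1 : ZMod 2), (1 : ZMod 2), z] τ := by
  rw [p_eq_thetaSum_mul, p_eq_thetaSum_mul, p_eq_thetaSum_mul, p_eq_thetaSum_mul]
  simp only [octad, cons_add_cons, empty_add_empty, zero_add, add_zero]
  ring

theorem zero_eq_char4 : (0 : Char4) = ![0, 0, 0, 0] := by decide

theorem R₁_eq_octad (τ : Matrix (Fin 4) (Fin 4) ℂ) :
    octad (thetaSum (gauss τ)) ![1, 0, 0, 0] ![0, 1, 0, 0] ![0, 0, 0, 1] 0 0 =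
      R₁ τ := by
  rw [zero_eq_char4]
  exact prod_p_eq_octad τ 0 0

theorem R₂_eq_octad (τ : Matrix (Fin 4) (Fin 4) ℂ) :
    octad (thetaSum (gauss τ)) ![1, 0, 0, 0] ![0, 1, 0, 0] ![0, 0, 0, 1] ![0, 0, 1, 0] 0 =
      R₂ τ := by
  rw [zero_eq_char4]
  exact prod_p_eq_octad τ 1 0

theorem R₃_eq_octad (τ : Matrix (Fin 4) (Fin 4) ℂ) :
    octad (thetaSum (gauss τ)) ![1, 0, 0, 0] ![0, 1, 0, 0] ![0, 0, 0, 1] 0 ![0, 0, 1, 0] =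
      R₃ τ := by
  rw [zero_eq_char4]
  exact prod_p_eq_octad τ 0 1

theorem gauss_octadDefect {τ : Matrix (Fin 4) (Fin 4) ℂ} (hτ : IsSiegel τ) :
    octadDefect (thetaSum (gauss τ)) 0 0 0 = -315 *
      octadDefect (thetaSum (gauss τ)) ![1, 0, 0, 0] ![0, 1, 0, 0] ![0, 0, 0, 1] := by
  have hs := summable_norm_gauss hτ
  have hs2 : Summable fun z => ‖gauss τ z ^ 2‖ := by
    refine ((hs.mul_norm hs).comp_injective
      (fun a b h => (Prod.mk.inj h).1 : Function.Injective fun z : Fin 4 → ℤ => (z, z))).congr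
      fun z => ?_
    simp [sq]
  refine octadDefect_zero (X := fun β σ => thetaSum (fun z => gauss τ z ^ 2) σ β)
    (fun β ε x => thetaSum_mul hs hs2 (gauss_sub_mul_gauss_add τ) β ε x)
    (fun β σ => ?_) ?_ ?_ ?_ ?_ ?_ ?_ ?_
  · rw [chi_comm]
    exact thetaSum_eq_chi_mul (fun z => by rw [gauss_neg]) σ β
  all_goals decide

/-- The modular form `R₁² + R₂² + R₃² − 2R₁R₂ − 2R₁R₃ − 2R₂R₃` obtained from the genus 3
theta relation via the van Geemen–van der Geer substitution agrees, up to a constant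
factor, with the Schottky–Igusa form `θ^{(4)}_{S(8)⊕S(8)} − θ^{(4)}_{S(16)}` on `ℍ_4`. -/
theorem vanGeemen_vanderGeer_eq_schottky_igusa :
    ∃ c : ℂ, ∀ τ : Matrix (Fin 4) (Fin 4) ℂ, IsSiegel τ →
      R₁ τ ^ 2 + R₂ τ ^ 2 + R₃ τ ^ 2 - 2 * R₁ τ * R₂ τ - 2 * R₁ τ * R₃ τ - 2 * R₂ τ * R₃ τ =
        c * (quadThetaSeries 16 4 E8E8Gram τ - quadThetaSeries 16 4 D16plusGram τ) := by
  refine ⟨4 / 315, fun τ hτ => ?_⟩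
  have hs := summable_norm_gauss hτ
  have h8 := sum_sum_thetaSum_pow (N := 8) (by decide) (by norm_num) hs
  have h16 := sum_sum_thetaSum_pow (N := 16) (by decide) (by norm_num) hs
  have h0 := octadDefect_zero_zero_zero (thetaSum (gauss τ))
  have hstd := octadDefect_standard (fun ε x => thetaSum_eq_chi_mul (gauss_neg τ) ε x)
    (R₁_eq_octad τ) (R₂_eq_octad τ) (R₃_eq_octad τ)
  rw [gauss_octadDefect hτ, hstd, h8, h16] at h0
  rw [quadThetaSeries_E8E8Gram hτ,
    quadThetaSeries_eq_latticeSum E8Basis_gram E8Basis_mulVec_injective range_E8Basis,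
    quadThetaSeries_eq_latticeSum D16plusBasis_gram D16plusBasis_mulVec_injective
      range_D16plusBasis]
  linear_combination h0 / 20160
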